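/- arXiv:2409.19240 — 4 statements merged into one kernel-verified Lean document; each statement's English description precedes it below -/
import Mathlib

section
/- Let a > 0, l₁ < l₂, T > 0, α₁, α₂ ∈ ℝ, and let w₀ : [l₁,l₂] → ℝ be continuous. Suppose u : [l₁,l₂] × [0,T] → ℝ is positive, twice continuously differentiable in x and once in t on (l₁,l₂) × (0,T], continuously differentiable in x up to the boundary, and satisfies: (i) u_t = a² u_xx on (l₁,l₂) × (0,T]; (ii) u(x,0) = u(l₁,0) exp( -(1/(2a²)) ∫_{l₁}^{x} w₀(y) dy ) for x ∈ [l₁,l₂]; (iii) α₁ u(l₁,t) + 2a² u_x(l₁,t) = 0 and α₂ u(l₂,t) + 2a² u_x(l₂,t) = 0 for t ∈ [0,T]. Then w = -2a² u_x/u satisfies the Burgers' equation w_t - a² w_xx + w w_x = 0 on (l₁,l₂) × (0,T], the initial condition w(x,0) = w₀(x) on [l₁,l₂], and the Dirichlet boundary conditions w(l₁,t) = α₁ and w(l₂,t) = α₂ for t ∈ [0,T]. -/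
open Real Set

section

open Filter Topology MeasureTheory Function

/-- At a local maximum the second derivative is nonpositive. -/
theorem second_deriv_nonpos_of_isLocalMax {f f' : ℝ → ℝ} {d x : ℝ} (hmax : IsLocalMax f x)
    (hf : ∀ᶠ y in 𝓝 x, HasDerivAt f (f' y) y) (hf' : HasDerivAt f' d x) : d ≤ 0 := by
  by_contra! hd
  have hde : deriv f =ᶠ[𝓝 x] f' := hf.mono fun y hy => hy.deriv
  have hmin : IsLocalMin f x := by
    refine isLocalMin_of_deriv_deriv_pos ?_ hmax.deriv_eq_zero hf.self_of_nhds.continuousAt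
    rw [hde.deriv_eq, hf'.deriv]
    exact hd
  have hconst : f =ᶠ[𝓝 x] fun _ => f x := by
    filter_upwards [hmax, hmin] with y h1 h2 using le_antisymm h1 h2
  have h0 : f' =ᶠ[𝓝 x] fun _ => (0 : ℝ) := by
    filter_upwards [hconst.eventuallyEq_nhds, hf] with y hy hy'
    exact hy'.unique ((hasDerivAt_const y (f x)).congr_of_eventuallyEq hy)
  have := hf'.unique ((hasDerivAt_const x (0 : ℝ)).congr_of_eventuallyEq h0)
  exact hd.ne' this

/-- At a maximum over an interval to the left, a one-sided derivative is nonnegative. -/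
theorem deriv_nonneg_of_le_left {f : ℝ → ℝ} {d s t : ℝ} (hst : s < t)
    (hf : HasDerivWithinAt f d (Icc s t) t) (hmax : ∀ r ∈ Icc s t, f r ≤ f t) : 0 ≤ d := by
  rw [hasDerivWithinAt_iff_tendsto_slope] at hf
  have hne : (𝓝[Icc s t \ {t}] t).NeBot := by
    rw [Icc_sdiff_right]
    exact right_nhdsWithin_Ico_neBot hst
  refine ge_of_tendsto hf (eventually_nhdsWithin_of_forall ?_)
  rintro r ⟨hr, hrt⟩
  rw [slope_def_field]
  exact div_nonneg_of_nonpos (by linarith [hmax r hr]) (by linarith [hr.2])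

/-- Maximum principle on a rectangle for strict subsolutions of the heat equation. -/
theorem nonpos_of_strict_subsolution {k x₁ x₂ s₁ s₂ : ℝ} {f fx fxx ft : ℝ → ℝ → ℝ}
    (hk : 0 < k)
    (hc : ContinuousOn (uncurry f) (Icc x₁ x₂ ×ˢ Icc s₁ s₂))
    (hx : ∀ x ∈ Ioo x₁ x₂, ∀ t ∈ Ioc s₁ s₂, HasDerivAt (fun y => f y t) (fx x t) x)
    (hxx : ∀ x ∈ Ioo x₁ x₂, ∀ t ∈ Ioc s₁ s₂, HasDerivAt (fun y => fx y t) (fxx x t) x)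
    (ht : ∀ x ∈ Ioo x₁ x₂, ∀ t ∈ Ioc s₁ s₂, HasDerivWithinAt (f x) (ft x t) (Icc s₁ s₂) t)
    (hlt : ∀ x ∈ Ioo x₁ x₂, ∀ t ∈ Ioc s₁ s₂, ft x t < k * fxx x t)
    (hb₁ : ∀ t ∈ Icc s₁ s₂, f x₁ t ≤ 0) (hb₂ : ∀ t ∈ Icc s₁ s₂, f x₂ t ≤ 0)
    (hb : ∀ x ∈ Icc x₁ x₂, f x s₁ ≤ 0) :
    ∀ x ∈ Icc x₁ x₂, ∀ t ∈ Icc s₁ s₂, f x t ≤ 0 := by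
  intro x hxm t htm
  obtain ⟨⟨y, r⟩, ⟨hy, hr⟩, hmax⟩ := (isCompact_Icc.prod isCompact_Icc).exists_isMaxOn
    ⟨(x, t), hxm, htm⟩ hc
  have hmax' : ∀ a ∈ Icc x₁ x₂, ∀ b ∈ Icc s₁ s₂, f a b ≤ f y r := fun a ha b hb' =>
    hmax (show (a, b) ∈ Icc x₁ x₂ ×ˢ Icc s₁ s₂ from ⟨ha, hb'⟩)
  refine (hmax' x hxm t htm).trans ?_
  rcases eq_or_lt_of_le hy.1 with h | h1
  · simp only at h; rw [← h]; exact hb₁ r hr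
  rcases eq_or_lt_of_le hy.2 with h | h2
  · simp only at h; rw [h]; exact hb₂ r hr
  rcases eq_or_lt_of_le hr.1 with h | h3
  · simp only at h; rw [← h]; exact hb y hy
  exfalso
  have hyo : y ∈ Ioo x₁ x₂ := ⟨h1, h2⟩
  have hro : r ∈ Ioc s₁ s₂ := ⟨h3, hr.2⟩
  have e1 : fxx y r ≤ 0 := by
    refine second_deriv_nonpos_of_isLocalMax (f := fun a => f a r) ?_ ?_ (hxx y hyo r hro)
    · filter_upwards [Ioo_mem_nhds h1 h2] with a ha using hmax' a (Ioo_subset_Icc_self ha) r hr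
    · filter_upwards [Ioo_mem_nhds h1 h2] with a ha using hx a ha r hro
  have e2 : 0 ≤ ft y r :=
    deriv_nonneg_of_le_left h3 ((ht y hyo r hro).mono (Icc_subset_Icc_right hr.2))
      fun b hb' => hmax' y hy b ⟨hb'.1, hb'.2.trans hr.2⟩
  nlinarith [hlt y hyo r hro]

/-- `f` is a continuous pointwise solution of `f_t = k f_xx` on a rectangle, with spatial
derivatives `fx` and `fxx`. -/
structure IsCaloricOn (k : ℝ) (f fx fxx : ℝ → ℝ → ℝ) (x₁ x₂ s₁ s₂ : ℝ) : Prop where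
  continuousOn : ContinuousOn (uncurry f) (Icc x₁ x₂ ×ˢ Icc s₁ s₂)
  hasDerivAt : ∀ x ∈ Ioo x₁ x₂, ∀ t ∈ Ioc s₁ s₂, HasDerivAt (fun y => f y t) (fx x t) x
  hasDerivAt_fx : ∀ x ∈ Ioo x₁ x₂, ∀ t ∈ Ioc s₁ s₂, HasDerivAt (fun y => fx y t) (fxx x t) x
  hasDerivWithinAt : ∀ x ∈ Ioo x₁ x₂, ∀ t ∈ Ioc s₁ s₂,
    HasDerivWithinAt (f x) (k * fxx x t) (Icc s₁ s₂) t

namespace IsCaloricOn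

variable {k x₁ x₂ s₁ s₂ : ℝ} {f fx fxx g gx gxx : ℝ → ℝ → ℝ}

theorem mono (h : IsCaloricOn k f fx fxx x₁ x₂ s₁ s₂) {y₁ y₂ r₁ r₂ : ℝ}
    (h1 : x₁ ≤ y₁) (h2 : y₂ ≤ x₂) (h3 : s₁ ≤ r₁) (h4 : r₂ ≤ s₂) :
    IsCaloricOn k f fx fxx y₁ y₂ r₁ r₂ where
  continuousOn := h.continuousOn.mono (prod_mono (Icc_subset_Icc h1 h2) (Icc_subset_Icc h3 h4))
  hasDerivAt x hx t ht := h.hasDerivAt x (Ioo_subset_Ioo h1 h2 hx) t (Ioc_subset_Ioc h3 h4 ht)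
  hasDerivAt_fx x hx t ht :=
    h.hasDerivAt_fx x (Ioo_subset_Ioo h1 h2 hx) t (Ioc_subset_Ioc h3 h4 ht)
  hasDerivWithinAt x hx t ht :=
    (h.hasDerivWithinAt x (Ioo_subset_Ioo h1 h2 hx) t (Ioc_subset_Ioc h3 h4 ht)).mono
      (Icc_subset_Icc h3 h4)

theorem sub (hf : IsCaloricOn k f fx fxx x₁ x₂ s₁ s₂) (hg : IsCaloricOn k g gx gxx x₁ x₂ s₁ s₂) :
    IsCaloricOn k (fun x t => f x t - g x t) (fun x t => fx x t - gx x t)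
      (fun x t => fxx x t - gxx x t) x₁ x₂ s₁ s₂ where
  continuousOn := hf.continuousOn.sub hg.continuousOn
  hasDerivAt x hx t ht := (hf.hasDerivAt x hx t ht).sub (hg.hasDerivAt x hx t ht)
  hasDerivAt_fx x hx t ht := (hf.hasDerivAt_fx x hx t ht).sub (hg.hasDerivAt_fx x hx t ht)
  hasDerivWithinAt x hx t ht := by
    rw [mul_sub]
    exact (hf.hasDerivWithinAt x hx t ht).sub (hg.hasDerivWithinAt x hx t ht)

theorem const_mul (c : ℝ) (hf : IsCaloricOn k f fx fxx x₁ x₂ s₁ s₂) :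
    IsCaloricOn k (fun x t => c * f x t) (fun x t => c * fx x t)
      (fun x t => c * fxx x t) x₁ x₂ s₁ s₂ where
  continuousOn := hf.continuousOn.const_mul c
  hasDerivAt x hx t ht := (hf.hasDerivAt x hx t ht).const_mul c
  hasDerivAt_fx x hx t ht := (hf.hasDerivAt_fx x hx t ht).const_mul c
  hasDerivWithinAt x hx t ht := by
    rw [mul_left_comm]
    exact (hf.hasDerivWithinAt x hx t ht).const_mul c

theorem translate (hf : IsCaloricOn k f fx fxx x₁ x₂ s₁ s₂) (a b : ℝ) {y₁ y₂ r₁ r₂ : ℝ}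
    (h1 : x₁ ≤ y₁ + a) (h2 : y₂ + a ≤ x₂) (h3 : s₁ ≤ r₁ + b) (h4 : r₂ + b ≤ s₂) :
    IsCaloricOn k (fun x t => f (x + a) (t + b)) (fun x t => fx (x + a) (t + b))
      (fun x t => fxx (x + a) (t + b)) y₁ y₂ r₁ r₂ := by
  have hX : ∀ x ∈ Ioo y₁ y₂, x + a ∈ Ioo x₁ x₂ := fun x hx =>
    ⟨by linarith [hx.1], by linarith [hx.2]⟩
  have hT : ∀ t ∈ Ioc r₁ r₂, t + b ∈ Ioc s₁ s₂ := fun t ht =>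
    ⟨by linarith [ht.1], by linarith [ht.2]⟩
  refine ⟨?_, fun x hx t ht => ?_, fun x hx t ht => ?_, fun x hx t ht => ?_⟩
  · refine hf.continuousOn.comp (f := fun z : ℝ × ℝ => (z.1 + a, z.2 + b)) (by fun_prop) ?_
    rintro ⟨x, t⟩ ⟨hx, ht⟩
    exact ⟨⟨by linarith [hx.1], by linarith [hx.2]⟩, ⟨by linarith [ht.1], by linarith [ht.2]⟩⟩
  · exact (hf.hasDerivAt _ (hX x hx) _ (hT t ht)).comp_add_const x a
  · exact (hf.hasDerivAt_fx _ (hX x hx) _ (hT t ht)).comp_add_const x a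
  · have hmaps : MapsTo (fun s : ℝ => s + b) (Icc r₁ r₂) (Icc s₁ s₂) := fun s hs =>
      ⟨by linarith [hs.1], by linarith [hs.2]⟩
    have := (hf.hasDerivWithinAt _ (hX x hx) _ (hT t ht)).comp t
      ((hasDerivWithinAt_id t _).add_const b) hmaps
    simpa [Function.comp_def] using this

/-- Interior Lipschitz estimate in space: odd reflection and a quadratic barrier. -/
theorem sub_le_mul (hf : IsCaloricOn k f fx fxx x₁ x₂ s₁ s₂) (hk : 0 < k) {M r ρ : ℝ}
    (hM : 0 < M) (hr : 0 < r) (hρ : 0 < ρ)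
    (hb : ∀ x ∈ Icc x₁ x₂, ∀ t ∈ Icc s₁ s₂, |f x t| ≤ M) {ξ t η : ℝ}
    (h1 : x₁ ≤ ξ - r) (h2 : ξ + r ≤ x₂) (ht1 : s₁ + ρ ≤ t) (ht2 : t ≤ s₂)
    (hη0 : 0 ≤ η) (hηr : η ≤ r) :
    f (ξ + η) t - f (ξ - η) t ≤ 2 * M * (r / (ρ * k) + 1 / r) * η := by
  set F := 1 / (ρ * k) with hF
  have hFpos : 0 < F := by positivity
  have hbox : ∀ y ∈ Icc 0 r, ξ + y ∈ Icc x₁ x₂ ∧ ξ - y ∈ Icc x₁ x₂ := fun y hy =>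
    ⟨⟨by linarith [hy.1], by linarith [hy.2]⟩, ⟨by linarith [hy.2], by linarith [hy.1]⟩⟩
  have hboxo : ∀ y ∈ Ioo 0 r, ξ + y ∈ Ioo x₁ x₂ ∧ ξ - y ∈ Ioo x₁ x₂ := fun y hy =>
    ⟨⟨by linarith [hy.1], by linarith [hy.2]⟩, ⟨by linarith [hy.2], by linarith [hy.1]⟩⟩
  have hT : ∀ s ∈ Ioc (t - ρ) t, s ∈ Ioc s₁ s₂ := fun s hs =>
    ⟨by linarith [hs.1], by linarith [hs.2]⟩
  have hTc : Icc (t - ρ) t ⊆ Icc s₁ s₂ := Icc_subset_Icc (by linarith) ht2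
  have hE : ∀ y ∈ Icc 0 r, 0 ≤ (F * r + 1 / r) * y - F * y ^ 2 := fun y hy => by
    have h : 0 ≤ 1 / r * y := mul_nonneg (by positivity) hy.1
    nlinarith [mul_nonneg (mul_nonneg hFpos.le hy.1) (sub_nonneg.2 hy.2)]
  have hρt : ∀ s ∈ Icc (t - ρ) t, 0 ≤ (t - s) / ρ := fun s hs =>
    div_nonneg (by linarith [hs.2]) hρ.le
  have hdiff : ∀ y ∈ Icc 0 r, ∀ s ∈ Icc (t - ρ) t, f (ξ + y) s - f (ξ - y) s ≤ 2 * M := by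
    intro y hy s hs
    have e1 := abs_le.1 (hb _ (hbox y hy).1 s (hTc hs))
    have e2 := abs_le.1 (hb _ (hbox y hy).2 s (hTc hs))
    linarith [e1.2, e2.1]
  have key := nonpos_of_strict_subsolution (k := k) (x₁ := 0) (x₂ := r) (s₁ := t - ρ) (s₂ := t)
    (f := fun y s => f (ξ + y) s - f (ξ - y) s -
      2 * M * ((t - s) / ρ + ((F * r + 1 / r) * y - F * y ^ 2)))
    (fx := fun y s => fx (ξ + y) s + fx (ξ - y) s - 2 * M * ((F * r + 1 / r) - F * (2 * y)))
    (fxx := fun y s => fxx (ξ + y) s - fxx (ξ - y) s + 4 * M * F)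
    (ft := fun y s => k * fxx (ξ + y) s - k * fxx (ξ - y) s + 2 * M / ρ) hk
    ?_ ?_ ?_ ?_ ?_ ?_ ?_ ?_ η ⟨hη0, hηr⟩ t ⟨by linarith, le_rfl⟩
  · have h3 : 0 ≤ M * F * η ^ 2 := by positivity
    have h4 : r / (ρ * k) = F * r := by rw [hF]; ring
    rw [h4]
    simp only [sub_self, zero_div, zero_add] at key
    nlinarith
  · refine (ContinuousOn.sub ?_ ?_).sub (by fun_prop)
    · refine hf.continuousOn.comp (f := fun z : ℝ × ℝ => (ξ + z.1, z.2)) (by fun_prop) ?_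
      rintro ⟨y, s⟩ ⟨hy, hs⟩
      exact ⟨(hbox y hy).1, hTc hs⟩
    · refine hf.continuousOn.comp (f := fun z : ℝ × ℝ => (ξ - z.1, z.2)) (by fun_prop) ?_
      rintro ⟨y, s⟩ ⟨hy, hs⟩
      exact ⟨(hbox y hy).2, hTc hs⟩
  · intro y hy s hs
    have e1 := (hf.hasDerivAt _ (hboxo y hy).1 s (hT s hs)).comp_const_add ξ y
    have e2 := (hf.hasDerivAt _ (hboxo y hy).2 s (hT s hs)).comp_const_sub ξ y
    have e3 : HasDerivAt (fun y : ℝ => (t - s) / ρ + ((F * r + 1 / r) * y - F * y ^ 2))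
        ((F * r + 1 / r) - F * (2 * y)) y := by
      have := (((hasDerivAt_id y).const_mul (F * r + 1 / r)).sub
        (((hasDerivAt_id y).pow 2).const_mul F)).const_add ((t - s) / ρ)
      simpa using this
    exact ((e1.sub e2).sub (e3.const_mul (2 * M))).congr_deriv (by ring)
  · intro y hy s hs
    have e1 := (hf.hasDerivAt_fx _ (hboxo y hy).1 s (hT s hs)).comp_const_add ξ y
    have e2 := (hf.hasDerivAt_fx _ (hboxo y hy).2 s (hT s hs)).comp_const_sub ξ y
    have e3 : HasDerivAt (fun y : ℝ => (F * r + 1 / r) - F * (2 * y)) (-(F * 2)) y := by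
      have := (((hasDerivAt_id y).const_mul 2).const_mul F).const_sub (F * r + 1 / r)
      simpa using this
    exact ((e1.add e2).sub (e3.const_mul (2 * M))).congr_deriv (by ring)
  · intro y hy s hs
    have e1 := (hf.hasDerivWithinAt _ (hboxo y hy).1 s (hT s hs)).mono hTc
    have e2 := (hf.hasDerivWithinAt _ (hboxo y hy).2 s (hT s hs)).mono hTc
    have e3 : HasDerivWithinAt (fun s : ℝ => (t - s) / ρ + ((F * r + 1 / r) * y - F * y ^ 2))
        (-1 / ρ) (Icc (t - ρ) t) s :=
      (((hasDerivWithinAt_id s _).const_sub t).div_const ρ).add_const _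
    exact ((e1.sub e2).sub (e3.const_mul (2 * M))).congr_deriv (by ring)
  · intro y hy s hs
    have : k * (4 * M * F) = 4 * M / ρ := by rw [hF]; field_simp
    have h5 : 0 < M / ρ := by positivity
    have h6 : 4 * M / ρ = 4 * (M / ρ) := by ring
    have h7 : 2 * M / ρ = 2 * (M / ρ) := by ring
    simp only [mul_add, mul_sub, this, h6, h7]
    linarith
  · intro s hs
    have := hρt s hs
    simp only [add_zero, sub_zero, sub_self, mul_zero, zero_sub, ne_eq, OfNat.ofNat_ne_zero,
      not_false_eq_true, zero_pow]
    nlinarith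
  · intro s hs
    have e1 := hρt s hs
    have e2 := hdiff r ⟨hr.le, le_rfl⟩ s hs
    have e3 : (F * r + 1 / r) * r - F * r ^ 2 = 1 := by field_simp; ring
    simp only [e3]
    nlinarith
  · intro y hy
    have e1 := hE y hy
    have e2 := hdiff y hy (t - ρ) ⟨le_rfl, by linarith⟩
    have e3 : (t - (t - ρ)) / ρ = 1 := by field_simp; ring
    simp only [e3]
    nlinarith

theorem abs_sub_le_mul (hf : IsCaloricOn k f fx fxx x₁ x₂ s₁ s₂) (hk : 0 < k) {M r ρ : ℝ}
    (hM : 0 < M) (hr : 0 < r) (hρ : 0 < ρ)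
    (hb : ∀ x ∈ Icc x₁ x₂, ∀ t ∈ Icc s₁ s₂, |f x t| ≤ M) {ξ t η : ℝ}
    (h1 : x₁ ≤ ξ - r) (h2 : ξ + r ≤ x₂) (ht1 : s₁ + ρ ≤ t) (ht2 : t ≤ s₂)
    (hη0 : 0 ≤ η) (hηr : η ≤ r) :
    |f (ξ + η) t - f (ξ - η) t| ≤ 2 * M * (r / (ρ * k) + 1 / r) * η := by
  rw [abs_le]
  constructor
  · have := (hf.const_mul (-1)).sub_le_mul hk hM hr hρ (by simpa using hb) h1 h2 ht1 ht2 hη0 hηr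
    linarith
  · exact hf.sub_le_mul hk hM hr hρ hb h1 h2 ht1 ht2 hη0 hηr

end IsCaloricOn

theorem abs_sub_sub_mul_le {g g' : ℝ → ℝ} {x r K h : ℝ} (hK : 0 ≤ K)
    (hg : ∀ y ∈ Icc (x - r) (x + r), HasDerivAt g (g' y) y)
    (hlip : ∀ y ∈ Icc (x - r) (x + r), |g' y - g' x| ≤ K * |y - x|) (hh : |h| ≤ r) :
    |g (x + h) - g x - h * g' x| ≤ K * h ^ 2 := by
  have habs := abs_le.1 hh
  have hsub : uIcc x (x + h) ⊆ Icc (x - r) (x + r) := by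
    have hr : 0 ≤ r := (abs_nonneg h).trans hh
    exact uIcc_subset_Icc ⟨by linarith, by linarith⟩ ⟨by linarith, by linarith⟩
  have := (convex_uIcc x (x + h)).norm_image_sub_le_of_norm_hasDerivWithin_le
    (f := fun y => g y - y * g' x) (f' := fun y => g' y - g' x) (C := K * |h|) (x := x)
    (y := x + h) (fun y hy => ?_) (fun y hy => ?_) left_mem_uIcc right_mem_uIcc
  · simp only [norm_eq_abs, add_sub_cancel_left] at this
    calc |g (x + h) - g x - h * g' x| = |g (x + h) - (x + h) * g' x - (g x - x * g' x)| := by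
          congr 1; ring
      _ ≤ K * |h| * |h| := this
      _ = K * h ^ 2 := by rw [mul_assoc, ← abs_mul, abs_of_nonneg (mul_self_nonneg h)]; ring
  · have := ((hg y (hsub hy)).sub ((hasDerivAt_id y).mul_const (g' x))).hasDerivWithinAt
      (s := uIcc x (x + h))
    exact this.congr_deriv (by ring)
  · refine (hlip y (hsub hy)).trans (mul_le_mul_of_nonneg_left ?_ hK)
    have := abs_sub_left_of_mem_uIcc hy
    simpa using this

/-- A pointwise limit of functions with uniformly Lipschitz derivatives is differentiable, and
the derivatives converge. -/
theorem exists_hasDerivAt_of_tendsto {ι : Type*} {l : Filter ι} [l.NeBot] {G G' : ι → ℝ → ℝ}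
    {g : ℝ → ℝ} {x r K : ℝ} (hr : 0 < r) (hK : 0 < K)
    (hG : ∀ᶠ i in l, ∀ y ∈ Icc (x - r) (x + r), HasDerivAt (G i) (G' i y) y)
    (hlip : ∀ᶠ i in l, ∀ y ∈ Icc (x - r) (x + r), |G' i y - G' i x| ≤ K * |y - x|)
    (hlim : ∀ y ∈ Icc (x - r) (x + r), Tendsto (fun i => G i y) l (𝓝 (g y))) :
    ∃ L, Tendsto (fun i => G' i x) l (𝓝 L) ∧ HasDerivAt g L x := by
  have htay : ∀ᶠ i in l, ∀ h, |h| ≤ r → |G i (x + h) - G i x - h * G' i x| ≤ K * h ^ 2 := by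
    filter_upwards [hG, hlip] with i h1 h2 h hh using abs_sub_sub_mul_le hK.le h1 h2 hh
  have hmem : ∀ h, |h| ≤ r → x + h ∈ Icc (x - r) (x + r) := fun h hh =>
    ⟨by linarith [(abs_le.1 hh).1], by linarith [(abs_le.1 hh).2]⟩
  have hx : x ∈ Icc (x - r) (x + r) := ⟨by linarith, by linarith⟩
  have hcau : Cauchy (map (fun i => G' i x) l) := by
    refine Metric.cauchy_iff.2 ⟨inferInstance, fun ε hε => ?_⟩
    set h := min r (ε / (8 * K)) with hh
    have hh0 : 0 < h := lt_min hr (by positivity)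
    have hhr : |h| ≤ r := by rw [abs_of_pos hh0]; exact min_le_left _ _
    have hKh : K * h ≤ ε / 8 := by
      have : h ≤ ε / (8 * K) := min_le_right _ _
      calc K * h ≤ K * (ε / (8 * K)) := by gcongr
        _ = ε / 8 := by field_simp
    refine ⟨Metric.ball ((g (x + h) - g x) / h) (ε / 2), ?_, fun a ha b hb => ?_⟩
    · have e1 : Tendsto (fun i => (G i (x + h) - G i x) / h) l (𝓝 ((g (x + h) - g x) / h)) :=
        ((hlim _ (hmem h hhr)).sub (hlim x hx)).div_const h
      rw [mem_map]
      filter_upwards [htay, Metric.tendsto_nhds.1 e1 (ε / 4) (by positivity)] with i h1 h2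
      simp only [mem_preimage, Metric.mem_ball, dist_eq] at h2 ⊢
      have h3 : |(G i (x + h) - G i x) / h - G' i x| ≤ K * h := by
        have : (G i (x + h) - G i x) / h - G' i x = (G i (x + h) - G i x - h * G' i x) / h := by
          field_simp
        rw [this, abs_div, abs_of_pos hh0, div_le_iff₀ hh0]
        calc _ ≤ K * h ^ 2 := h1 h hhr
          _ = _ := by ring
      have := abs_sub_le (G' i x) ((G i (x + h) - G i x) / h) ((g (x + h) - g x) / h)
      rw [abs_sub_comm] at h3
      linarith
    · have := dist_triangle_right a b ((g (x + h) - g x) / h)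
      simp only [Metric.mem_ball] at ha hb
      linarith
  obtain ⟨L, hL⟩ := CompleteSpace.complete hcau
  have hL' : Tendsto (fun i => G' i x) l (𝓝 L) := hL
  refine ⟨L, hL', ?_⟩
  have hbound : ∀ h, |h| ≤ r → |g (x + h) - g x - h * L| ≤ K * h ^ 2 := fun h hh =>
    le_of_tendsto ((((hlim _ (hmem h hh)).sub (hlim x hx)).sub (hL'.const_mul h)).abs)
      (htay.mono fun i hi => hi h hh)
  rw [hasDerivAt_iff_isLittleO_nhds_zero]
  have hO : (fun h => g (x + h) - g x - h • L) =O[𝓝 0] fun h : ℝ => h ^ 2 := by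
    refine Asymptotics.IsBigO.of_bound K ?_
    filter_upwards [Metric.closedBall_mem_nhds (0 : ℝ) hr] with h hh
    simp only [Metric.mem_closedBall, dist_zero_right, norm_eq_abs] at hh
    simpa using hbound h hh
  exact hO.trans_isLittleO (Asymptotics.isLittleO_pow_id one_lt_two)

namespace IsCaloricOn

variable {k x₁ x₂ s₁ s₂ : ℝ} {f fx fxx : ℝ → ℝ → ℝ}

theorem abs_fx_sub_le (hf : IsCaloricOn k f fx fxx x₁ x₂ s₁ s₂) (hk : 0 < k) {M r ρ : ℝ}
    (hM : 0 < M) (hr : 0 < r) (hρ : 0 < ρ)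
    (hb : ∀ x ∈ Icc x₁ x₂, ∀ t ∈ Icc s₁ s₂, |f x t| ≤ M) {x y t : ℝ}
    (hx : x ∈ Icc (x₁ + 2 * r) (x₂ - 2 * r)) (hy : y ∈ Icc (x₁ + 2 * r) (x₂ - 2 * r))
    (ht : t ∈ Icc (s₁ + 2 * ρ) s₂) (hxy : |y - x| ≤ 2 * r) :
    |fx y t - fx x t| ≤ (r / (ρ * k) + 1 / r) ^ 2 * M * |y - x| := by
  wlog hle : x ≤ y generalizing x y
  · rw [abs_sub_comm, abs_sub_comm y x]
    exact this hy hx (by rwa [abs_sub_comm]) (le_of_not_ge hle)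
  rw [abs_of_nonneg (sub_nonneg.2 hle)] at hxy ⊢
  set C := r / (ρ * k) + 1 / r with hC
  have hCpos : 0 < C := by positivity
  have hD : ∀ h ∈ Ioc 0 r, |(f (y + h) t - f (y - h) t) / (2 * h) -
      (f (x + h) t - f (x - h) t) / (2 * h)| ≤ C ^ 2 * M * (y - x) := by
    intro h hh
    have hh0 : 0 < 2 * h := by linarith [hh.1]
    have c1 := hf.translate h 0 (y₁ := x₁ + r) (y₂ := x₂ - r) (r₁ := s₁ + ρ) (r₂ := s₂)
      (by linarith [hh.1]) (by linarith [hh.2]) (by linarith) (by linarith)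
    have c2 := hf.translate (-h) 0 (y₁ := x₁ + r) (y₂ := x₂ - r) (r₁ := s₁ + ρ) (r₂ := s₂)
      (by linarith [hh.2]) (by linarith [hh.1]) (by linarith) (by linarith)
    have c3 := (c1.sub c2).const_mul (1 / (2 * h))
    have hb' : ∀ x ∈ Icc (x₁ + r) (x₂ - r), ∀ t ∈ Icc (s₁ + ρ) s₂,
        |1 / (2 * h) * (f (x + h) (t + 0) - f (x + -h) (t + 0))| ≤ C * M := by
      intro x hx t ht
      have := hf.abs_sub_le_mul hk hM hr hρ hb (ξ := x) (t := t) (η := h) (by linarith [hx.1])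
        (by linarith [hx.2]) ht.1 ht.2 hh.1.le hh.2
      rw [add_zero, ← sub_eq_add_neg, abs_mul, abs_of_pos (by positivity), one_div,
        inv_mul_le_iff₀ hh0]
      calc _ ≤ _ := this
        _ = _ := by ring
    have := c3.abs_sub_le_mul hk (mul_pos hCpos hM) hr hρ hb' (ξ := (x + y) / 2) (t := t)
      (η := (y - x) / 2) (by linarith [hx.1, hy.1]) (by linarith [hx.2, hy.2])
      (by linarith [ht.1]) ht.2 (by linarith) (by linarith)
    rw [show (x + y) / 2 + (y - x) / 2 = y by ring, show (x + y) / 2 - (y - x) / 2 = x by ring]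
      at this
    simp only [add_zero, ← sub_eq_add_neg] at this
    calc _ = |1 / (2 * h) * (f (y + h) t - f (y - h) t) -
          1 / (2 * h) * (f (x + h) t - f (x - h) t)| := by congr 1; ring
      _ ≤ _ := this
      _ = _ := by ring
  have hlim : ∀ z ∈ Ioo x₁ x₂, Tendsto (fun h => (f (z + h) t - f (z - h) t) / (2 * h))
      (𝓝[>] 0) (𝓝 (fx z t)) := by
    intro z hz
    have hd := hf.hasDerivAt z hz t ⟨by linarith [ht.1], ht.2⟩
    have d1 : HasDerivAt (fun h => f (z + h) t - f (z - h) t) (fx z t - -fx z t) 0 := by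
      have e1 := HasDerivAt.comp_const_add (f := fun y => f y t) z 0 (by simpa using hd)
      have e2 := HasDerivAt.comp_const_sub (f := fun y => f y t) z 0 (by simpa using hd)
      exact e1.sub e2
    have d2 := (d1.tendsto_slope_zero_right).div_const 2
    refine (d2.congr fun h => ?_).trans_eq (by congr 1; ring)
    simp
    ring
  refine le_of_tendsto ((hlim y ?_).sub (hlim x ?_)).abs ?_
  · constructor <;> linarith [hy.1, hy.2]
  · constructor <;> linarith [hx.1, hx.2]
  · filter_upwards [Ioc_mem_nhdsGT hr] with h hh using hD h hh

theorem abs_fxx_le (hf : IsCaloricOn k f fx fxx x₁ x₂ s₁ s₂) (hk : 0 < k) {M r ρ : ℝ}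
    (hM : 0 < M) (hr : 0 < r) (hρ : 0 < ρ)
    (hb : ∀ x ∈ Icc x₁ x₂, ∀ t ∈ Icc s₁ s₂, |f x t| ≤ M) {x t : ℝ}
    (hx : x ∈ Icc (x₁ + 3 * r) (x₂ - 3 * r)) (ht : t ∈ Icc (s₁ + 2 * ρ) s₂) :
    |fxx x t| ≤ (r / (ρ * k) + 1 / r) ^ 2 * M := by
  refine (hf.hasDerivAt_fx x ⟨by linarith [hx.1], by linarith [hx.2]⟩ t
    ⟨by linarith [ht.1], ht.2⟩).le_of_lip' (by positivity) ?_
  filter_upwards [Icc_mem_nhds (sub_lt_self x hr) (lt_add_of_pos_right x hr)] with y hy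
  refine hf.abs_fx_sub_le hk hM hr hρ hb ⟨by linarith [hx.1], by linarith [hx.2]⟩
    ⟨by linarith [hx.1, hy.1], by linarith [hx.2, hy.2]⟩ ht ?_
  rw [abs_le]
  constructor <;> linarith [hy.1, hy.2]

theorem abs_sub_time_le (hf : IsCaloricOn k f fx fxx x₁ x₂ s₁ s₂) {N x : ℝ}
    (hx : x ∈ Ioo x₁ x₂) {s t r₁ r₂ : ℝ} (h1 : s₁ < r₁) (h2 : r₂ ≤ s₂)
    (hN : ∀ s ∈ Icc r₁ r₂, |k * fxx x s| ≤ N)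
    (hs : s ∈ Icc r₁ r₂) (ht : t ∈ Icc r₁ r₂) : |f x t - f x s| ≤ N * |t - s| := by
  refine (convex_Icc r₁ r₂).norm_image_sub_le_of_norm_hasDerivWithin_le
    (f' := fun s => k * fxx x s) (fun s hs => ?_) hN hs ht
  exact (hf.hasDerivWithinAt x hx s ⟨h1.trans_le hs.1, hs.2.trans h2⟩).mono
    (Icc_subset_Icc h1.le h2)

/-- The spatial derivative of a solution is again a solution. -/
theorem exists_isCaloricOn_fx (hf : IsCaloricOn k f fx fxx x₁ x₂ s₁ s₂) (hk : 0 < k)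
    {y₁ y₂ r₁ : ℝ} (h1 : x₁ < y₁) (h2 : y₂ < x₂) (h3 : s₁ < r₁) :
    ∃ fxxx, IsCaloricOn k fx fxx fxxx y₁ y₂ r₁ s₂ := by
  obtain ⟨M₀, hM₀⟩ := (isCompact_Icc.prod isCompact_Icc).exists_bound_of_continuousOn
    hf.continuousOn
  set M := |M₀| + 1
  have hM : 0 < M := by positivity
  have hb : ∀ x ∈ Icc x₁ x₂, ∀ t ∈ Icc s₁ s₂, |f x t| ≤ M := fun x hx t ht =>
    (hM₀ (x, t) ⟨hx, ht⟩).trans ((le_abs_self M₀).trans (le_add_of_nonneg_right zero_le_one))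
  obtain ⟨r, hr, hr1, hr2⟩ : ∃ r, 0 < r ∧ x₁ + 6 * r ≤ y₁ ∧ y₂ ≤ x₂ - 6 * r := by
    refine ⟨min (y₁ - x₁) (x₂ - y₂) / 6, by
      have := lt_min (sub_pos.2 h1) (sub_pos.2 h2); positivity, ?_, ?_⟩
    · linarith [min_le_left (y₁ - x₁) (x₂ - y₂)]
    · linarith [min_le_right (y₁ - x₁) (x₂ - y₂)]
  obtain ⟨ρ, hρ, hρ1⟩ : ∃ ρ, 0 < ρ ∧ s₁ + 5 * ρ ≤ r₁ := ⟨(r₁ - s₁) / 5, by linarith, by linarith⟩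
  set C := r / (ρ * k) + 1 / r with hC
  have hCpos : 0 < C := by positivity
  set K := C ^ 2 * M with hKdef
  have hK : 0 < K := by positivity
  have htime : ∀ x ∈ Icc (x₁ + 3 * r) (x₂ - 3 * r), ∀ s ∈ Icc (s₁ + 2 * ρ) s₂,
      ∀ t ∈ Icc (s₁ + 2 * ρ) s₂, |f x t - f x s| ≤ k * K * |t - s| := by
    intro x hx s hs t ht
    refine hf.abs_sub_time_le ⟨by linarith [hx.1], by linarith [hx.2]⟩ (by linarith) le_rfl
      (fun s hs => ?_) hs ht
    rw [abs_mul, abs_of_pos hk]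
    exact mul_le_mul_of_nonneg_left (hf.abs_fxx_le hk hM hr hρ hb hx hs) hk.le
  -- difference quotients in time have uniformly Lipschitz spatial derivatives
  have hquot : ∀ s ∈ Icc (s₁ + 4 * ρ) s₂, ∀ t ∈ Icc (s₁ + 4 * ρ) s₂, s < t →
      ∀ x ∈ Icc (x₁ + 5 * r) (x₂ - 5 * r), ∀ y ∈ Icc (x₁ + 5 * r) (x₂ - 5 * r),
      |y - x| ≤ 2 * r →
      |(fx y t - fx y s) / (t - s) - (fx x t - fx x s) / (t - s)| ≤
        C ^ 2 * (k * K) * |y - x| := by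
    intro s hs t ht hst x hx y hy hxy
    have hts : 0 < t - s := sub_pos.2 hst
    have c := ((hf.translate 0 (t - s) (y₁ := x₁ + 3 * r) (y₂ := x₂ - 3 * r)
      (r₁ := s₁ + 2 * ρ) (r₂ := s) (by linarith) (by linarith) (by linarith) (by linarith [ht.2])).sub
      (hf.mono (by linarith) (by linarith) (by linarith) hs.2)).const_mul (1 / (t - s))
    have := c.abs_fx_sub_le hk (M := k * K) (by positivity) hr hρ (fun z hz b hb' => ?_)
      (x := x) (y := y) (t := s) ⟨by linarith [hx.1], by linarith [hx.2]⟩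
      ⟨by linarith [hy.1], by linarith [hy.2]⟩ ⟨by linarith [hs.1], le_rfl⟩ hxy
    · simp only [add_zero, add_sub_cancel] at this
      refine le_trans (le_of_eq ?_) this
      congr 1
      ring
    · have hb2 : b ≤ s₂ := hb'.2.trans hs.2
      have := htime z hz b ⟨hb'.1, hb2⟩ (b + (t - s))
        ⟨by linarith [hb'.1], by linarith [hb'.2, ht.2]⟩
      rw [add_zero, abs_mul, abs_of_pos (by positivity), one_div, inv_mul_le_iff₀ hts]
      rw [add_sub_cancel_left, abs_of_pos hts] at this
      linarith
  have hL : ∀ x t, ∃ L, x ∈ Icc y₁ y₂ → t ∈ Ioc r₁ s₂ →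
      HasDerivWithinAt (fx x) L (Icc r₁ s₂) t ∧
      HasDerivAt (fun y => k * fxx y t) L x := by
    intro x t
    by_cases hxt : x ∈ Icc y₁ y₂ ∧ t ∈ Ioc r₁ s₂
    swap
    · exact ⟨0, fun h h' => (hxt ⟨h, h'⟩).elim⟩
    obtain ⟨hx, ht⟩ := hxt
    have hne : (𝓝[Icc r₁ s₂ \ {t}] t).NeBot :=
      (right_nhdsWithin_Ico_neBot ht.1).mono (nhdsWithin_mono _ fun b hb =>
        ⟨⟨hb.1, hb.2.le.trans ht.2⟩, hb.2.ne⟩)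
    have hsub : Icc (x - r) (x + r) ⊆ Icc (x₁ + 5 * r) (x₂ - 5 * r) :=
      Icc_subset_Icc (by linarith [hx.1]) (by linarith [hx.2])
    have hoo : ∀ y ∈ Icc (x - r) (x + r), y ∈ Ioo x₁ x₂ := fun y hy =>
      ⟨by linarith [(hsub hy).1], by linarith [(hsub hy).2]⟩
    have htt : t ∈ Icc (s₁ + 4 * ρ) s₂ := ⟨by linarith [ht.1], ht.2⟩
    have hex := exists_hasDerivAt_of_tendsto (l := 𝓝[Icc r₁ s₂ \ {t}] t)
      (G := fun s y => slope (f y) t s) (G' := fun s y => slope (fx y) t s)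
      (g := fun y => k * fxx y t) (x := x) (K := C ^ 2 * (k * K)) hr (by positivity) ?_ ?_ ?_
    · obtain ⟨L, hL1, hL2⟩ := hex
      exact ⟨L, fun _ _ => ⟨hasDerivWithinAt_iff_tendsto_slope.2 hL1, hL2⟩⟩
    · refine eventually_nhdsWithin_of_forall fun s hs y hy => ?_
      simp only [slope_def_field]
      exact ((hf.hasDerivAt y (hoo y hy) s ⟨by linarith [hs.1.1], hs.1.2⟩).sub
        (hf.hasDerivAt y (hoo y hy) t ⟨by linarith [ht.1], ht.2⟩)).div_const _
    · refine eventually_nhdsWithin_of_forall fun s hs y hy => ?_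
      have hss : s ∈ Icc (s₁ + 4 * ρ) s₂ := ⟨by linarith [hs.1.1], hs.1.2⟩
      have hxx : x ∈ Icc (x₁ + 5 * r) (x₂ - 5 * r) := hsub ⟨by linarith, by linarith⟩
      have hyx : |y - x| ≤ 2 * r := by
        rw [abs_le]; constructor <;> linarith [hy.1, hy.2]
      rcases lt_or_gt_of_ne (show s ≠ t from hs.2) with hlt | hlt
      · rw [slope_comm, slope_comm (fx x), slope_def_field, slope_def_field]
        exact hquot s hss t htt hlt x hxx y (hsub hy) hyx
      · rw [slope_def_field, slope_def_field]
        exact hquot t htt s hss hlt x hxx y (hsub hy) hyx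
    · intro y hy
      exact hasDerivWithinAt_iff_tendsto_slope.1
        ((hf.hasDerivWithinAt y (hoo y hy) t ⟨by linarith [ht.1], ht.2⟩).mono
          (Icc_subset_Icc_left h3.le))
  choose L hL using hL
  refine ⟨fun x t => L x t / k, ?_, fun x hx t ht => ?_, fun x hx t ht => ?_,
    fun x hx t ht => ?_⟩
  · -- uniform limit of spatial difference quotients
    have hunif : TendstoUniformlyOn
        (fun (h : ℝ) (z : ℝ × ℝ) => (f (z.1 + h) z.2 - f z.1 z.2) / h) (uncurry fx)
        (𝓝[>] 0) (Icc y₁ y₂ ×ˢ Icc r₁ s₂) := by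
      rw [Metric.tendstoUniformlyOn_iff]
      intro ε hε
      filter_upwards [Ioo_mem_nhdsGT (lt_min hr (div_pos hε hK))] with h hh z hz
      have hh1 : h < r := hh.2.trans_le (min_le_left _ _)
      have hh2 : h * K < ε := (lt_div_iff₀ hK).1 (hh.2.trans_le (min_le_right _ _))
      obtain ⟨⟨hz1, hz2⟩, hz3, hz4⟩ := hz
      have := abs_sub_sub_mul_le (g := fun y => f y z.2) (g' := fun y => fx y z.2) (x := z.1)
        (r := r) (K := K) (h := h) hK.le (fun y hy => ?_) (fun y hy => ?_)
        (by rw [abs_of_pos hh.1]; exact hh1.le)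
      · rw [dist_comm, dist_eq]
        have e : (f (z.1 + h) z.2 - f z.1 z.2) / h - uncurry fx z =
            (f (z.1 + h) z.2 - f z.1 z.2 - h * fx z.1 z.2) / h := by
          have := hh.1.ne'
          simp only [uncurry]
          field_simp
        rw [e, abs_div, abs_of_pos hh.1, div_lt_iff₀ hh.1]
        nlinarith [hh.1]
      · exact hf.hasDerivAt y ⟨by linarith [hy.1], by linarith [hy.2]⟩ _ ⟨by linarith, hz4⟩
      · refine hf.abs_fx_sub_le hk hM hr hρ hb ⟨by linarith, by linarith⟩
          ⟨by linarith [hy.1], by linarith [hy.2]⟩ ⟨by linarith, hz4⟩ ?_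
        rw [abs_le]; constructor <;> linarith [hy.1, hy.2]
    refine hunif.continuousOn (Eventually.frequently ?_)
    filter_upwards [Ioo_mem_nhdsGT hr] with h hh
    refine (ContinuousOn.sub ?_ (hf.continuousOn.mono (prod_mono
      (Icc_subset_Icc h1.le h2.le) (Icc_subset_Icc_left h3.le)))).div_const h
    refine hf.continuousOn.comp (f := fun z : ℝ × ℝ => (z.1 + h, z.2)) (by fun_prop) ?_
    rintro ⟨y, s⟩ ⟨hy, hs⟩
    exact ⟨⟨by linarith [hy.1, hh.1], by linarith [hy.2, hh.2]⟩, ⟨by linarith [hs.1], hs.2⟩⟩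
  · exact hf.hasDerivAt_fx x (Ioo_subset_Ioo h1.le h2.le hx) t (Ioc_subset_Ioc_left h3.le ht)
  · have := ((hL x t (Ioo_subset_Icc_self hx) ht).2).div_const k
    simpa [hk.ne'] using this
  · rw [mul_div_cancel₀ _ hk.ne']
    exact (hL x t (Ioo_subset_Icc_self hx) ht).1

end IsCaloricOn

theorem integral_le_integral_of_integral_deriv_nonpos {H H' : ℝ → ℝ → ℝ} {a b s t : ℝ}
    (hab : a ≤ b) (hst : s ≤ t) (hc : ContinuousOn (uncurry H) (Icc a b ×ˢ Icc s t))
    (hc' : ContinuousOn (uncurry H') (Icc a b ×ˢ Icc s t))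
    (hd : ∀ y ∈ Icc a b, ∀ r ∈ Ioo s t, HasDerivAt (H y) (H' y r) r)
    (hle : ∀ r ∈ Ioo s t, ∫ y in a..b, H' y r ≤ 0) :
    ∫ y in a..b, H y t ≤ ∫ y in a..b, H y s := by
  have hint : ∀ r ∈ Icc s t, IntervalIntegrable (fun y => H y r) volume a b := fun r hr => by
    refine ContinuousOn.intervalIntegrable_of_Icc hab ?_
    exact hc.comp (f := fun y : ℝ => (y, r)) (by fun_prop) fun y hy => ⟨hy, hr⟩
  have hftc : ∀ y ∈ Icc a b, ∫ r in s..t, H' y r = H y t - H y s := by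
    intro y hy
    refine intervalIntegral.integral_eq_sub_of_hasDerivAt_of_le hst ?_ (hd y hy) ?_
    · exact hc.comp (f := fun r : ℝ => (y, r)) (by fun_prop) fun r hr => ⟨hy, hr⟩
    · refine ContinuousOn.intervalIntegrable_of_Icc hst ?_
      exact hc'.comp (f := fun r : ℝ => (y, r)) (by fun_prop) fun r hr => ⟨hy, hr⟩
  rw [← sub_nonpos, ← intervalIntegral.integral_sub (hint t ⟨hst, le_rfl⟩) (hint s ⟨le_rfl, hst⟩)]
  have e1 : ∫ y in a..b, (H y t - H y s) = ∫ y in a..b, ∫ r in s..t, H' y r := by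
    refine intervalIntegral.integral_congr fun y hy => ?_
    rw [uIcc_of_le hab] at hy
    exact (hftc y hy).symm
  rw [e1, intervalIntegral_intervalIntegral_swap, intervalIntegral.integral_of_le hst,
    integral_Ioc_eq_integral_Ioo]
  · exact setIntegral_nonpos measurableSet_Ioo hle
  · rw [uIoc_of_le hab, uIoc_of_le hst]
    exact (hc'.integrableOn_compact (isCompact_Icc.prod isCompact_Icc)).mono_set
      (prod_mono Ioc_subset_Icc_self Ioc_subset_Icc_self)

namespace IsCaloricOn

variable {k x₁ x₂ s₁ s₂ : ℝ} {f fx fxx : ℝ → ℝ → ℝ}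

theorem continuousOn_fx (hf : IsCaloricOn k f fx fxx x₁ x₂ s₁ s₂) (hk : 0 < k)
    {y₁ y₂ r₁ : ℝ} (h1 : x₁ < y₁) (h2 : y₂ < x₂) (h3 : s₁ < r₁) :
    ContinuousOn (uncurry fx) (Icc y₁ y₂ ×ˢ Icc r₁ s₂) :=
  (hf.exists_isCaloricOn_fx hk h1 h2 h3).choose_spec.continuousOn

theorem continuousOn_fxx (hf : IsCaloricOn k f fx fxx x₁ x₂ s₁ s₂) (hk : 0 < k)
    {y₁ y₂ r₁ : ℝ} (h1 : x₁ < y₁) (h2 : y₂ < x₂) (h3 : s₁ < r₁) :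
    ContinuousOn (uncurry fxx) (Icc y₁ y₂ ×ˢ Icc r₁ s₂) := by
  obtain ⟨a, ha1, ha2⟩ := exists_between h1
  obtain ⟨b, hb1, hb2⟩ := exists_between h2
  obtain ⟨c, hc1, hc2⟩ := exists_between h3
  obtain ⟨_, h⟩ := hf.exists_isCaloricOn_fx hk ha1 hb2 hc1
  exact h.continuousOn_fx hk ha2 hb1 hc2

theorem hasDerivAt_time (hf : IsCaloricOn k f fx fxx x₁ x₂ s₁ s₂) {x t : ℝ}
    (hx : x ∈ Ioo x₁ x₂) (ht : t ∈ Ioo s₁ s₂) : HasDerivAt (f x) (k * fxx x t) t :=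
  (hf.hasDerivWithinAt x hx t (Ioo_subset_Ioc_self ht)).hasDerivAt (Icc_mem_nhds ht.1 ht.2)

/-- The mass of a nonnegative solution at earlier times is controlled by its mass later on. -/
theorem integral_bump_mul_le (hf : IsCaloricOn k f fx fxx x₁ x₂ s₁ s₂) (hk : 0 < k)
    (hpos : ∀ x ∈ Icc x₁ x₂, ∀ t ∈ Icc s₁ s₂, 0 ≤ f x t) {a b s : ℝ} (h1 : x₁ < a)
    (hab : a < b) (h2 : b < x₂) (hs : s ∈ Ioc s₁ s₂) :
    exp (18 * k / (b - a) ^ 2 * s) * ∫ y in a..b, ((y - a) * (b - y)) ^ 2 * f y s ≤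
      exp (18 * k / (b - a) ^ 2 * s₂) * ∫ y in a..b, ((y - a) * (b - y)) ^ 2 * f y s₂ := by
  have hL : 0 < b - a := sub_pos.2 hab
  set l := 18 * k / (b - a) ^ 2 with hl
  have hcf : ContinuousOn (uncurry f) (Icc a b ×ˢ Icc s s₂) :=
    hf.continuousOn.mono (prod_mono (Icc_subset_Icc h1.le h2.le) (Icc_subset_Icc_left hs.1.le))
  have hcx := hf.continuousOn_fx hk h1 h2 hs.1
  have hcxx := hf.continuousOn_fxx hk h1 h2 hs.1
  have hIcc : ∀ y ∈ Icc a b, y ∈ Ioo x₁ x₂ := fun y hy =>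
    ⟨h1.trans_le hy.1, hy.2.trans_lt h2⟩
  have key := integral_le_integral_of_integral_deriv_nonpos (a := a) (b := b) (s := s) (t := s₂)
    (H := fun y r => -(exp (l * r) * (((y - a) * (b - y)) ^ 2 * f y r)))
    (H' := fun y r => -(exp (l * r) * (((y - a) * (b - y)) ^ 2 * (k * fxx y r)) +
      exp (l * r) * l * (((y - a) * (b - y)) ^ 2 * f y r))) hab.le hs.2 ?_ ?_ ?_ ?_
  · simp only [intervalIntegral.integral_neg, intervalIntegral.integral_const_mul,
      neg_le_neg_iff] at key
    exact key
  · have : ContinuousOn (fun z : ℝ × ℝ => f z.1 z.2) (Icc a b ×ˢ Icc s s₂) := hcf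
    simp only [uncurry_def]
    fun_prop
  · have e1 : ContinuousOn (fun z : ℝ × ℝ => f z.1 z.2) (Icc a b ×ˢ Icc s s₂) := hcf
    have e2 : ContinuousOn (fun z : ℝ × ℝ => fxx z.1 z.2) (Icc a b ×ˢ Icc s s₂) := hcxx
    simp only [uncurry_def]
    fun_prop
  · intro y hy r hr
    have e1 := hf.hasDerivAt_time (hIcc y hy) ⟨hs.1.trans hr.1, hr.2⟩
    have e2 : HasDerivAt (fun r => exp (l * r)) (exp (l * r) * l) r := by
      simpa using ((hasDerivAt_id r).const_mul l).exp
    exact (e2.mul (e1.const_mul _)).neg.congr_deriv (by ring)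
  · intro r hr
    have hrm : r ∈ Icc s s₂ := Ioo_subset_Icc_self hr
    have c0 : ContinuousOn (fun y => f y r) (Icc a b) :=
      hcf.comp (f := fun y : ℝ => (y, r)) (by fun_prop) fun y hy => ⟨hy, hrm⟩
    have c1 : ContinuousOn (fun y => fx y r) (Icc a b) :=
      hcx.comp (f := fun y : ℝ => (y, r)) (by fun_prop) fun y hy => ⟨hy, hrm⟩
    have c2 : ContinuousOn (fun y => fxx y r) (Icc a b) :=
      hcxx.comp (f := fun y : ℝ => (y, r)) (by fun_prop) fun y hy => ⟨hy, hrm⟩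
    have hrt : r ∈ Ioc s₁ s₂ := ⟨hs.1.trans hr.1, hr.2.le⟩
    -- Green's identity
    have hgreen : ∫ y in a..b, (((y - a) * (b - y)) ^ 2 * fxx y r -
        (2 * (b - y) ^ 2 - 8 * ((y - a) * (b - y)) + 2 * (y - a) ^ 2) * f y r) = 0 := by
      have := intervalIntegral.integral_eq_sub_of_hasDerivAt_of_le (a := a) (b := b)
        (f := fun y => ((y - a) * (b - y)) ^ 2 * fx y r -
          2 * ((y - a) * (b - y)) * (a + b - 2 * y) * f y r)
        (f' := fun y => ((y - a) * (b - y)) ^ 2 * fxx y r -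
        (2 * (b - y) ^ 2 - 8 * ((y - a) * (b - y)) + 2 * (y - a) ^ 2) * f y r) hab.le
        (by fun_prop) (fun y hy => ?_)
        (ContinuousOn.intervalIntegrable_of_Icc hab.le (by fun_prop))
      · rw [this]; ring
      · have hy' := hIcc y (Ioo_subset_Icc_self hy)
        have d0 : HasDerivAt (fun y => (y - a) * (b - y)) (a + b - 2 * y) y :=
          (((hasDerivAt_id y).sub_const a).mul ((hasDerivAt_id y).const_sub b)).congr_deriv
            (by simp only [id]; ring)
        have d1 : HasDerivAt (fun y => a + b - 2 * y) (-2) y :=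
          (((hasDerivAt_id y).const_mul 2).const_sub (a + b)).congr_deriv (by ring)
        exact (((d0.pow 2).mul (hf.hasDerivAt_fx y hy' r hrt)).sub
          (((d0.const_mul 2).mul d1).mul (hf.hasDerivAt y hy' r hrt))).congr_deriv
            (by simp only [Pi.pow_apply, Pi.mul_apply, Nat.cast_ofNat]; ring)
    have hle : ∫ y in a..b, -(exp (l * r) * (((y - a) * (b - y)) ^ 2 * (k * fxx y r)) +
        exp (l * r) * l * (((y - a) * (b - y)) ^ 2 * f y r)) ≤
        ∫ y in a..b, -(exp (l * r) * k) * (((y - a) * (b - y)) ^ 2 * fxx y r -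
        (2 * (b - y) ^ 2 - 8 * ((y - a) * (b - y)) + 2 * (y - a) ^ 2) * f y r) := by
      refine intervalIntegral.integral_mono_on hab.le
        (ContinuousOn.intervalIntegrable_of_Icc hab.le (by fun_prop))
        (ContinuousOn.intervalIntegrable_of_Icc hab.le (by fun_prop)) fun y hy => ?_
      have hfy := hpos y (Ioo_subset_Icc_self (hIcc y hy)) r (Ioc_subset_Icc_self hrt)
      have hsq : 2 * (b - y) ^ 2 - 8 * ((y - a) * (b - y)) + 2 * (y - a) ^ 2 +
          18 / (b - a) ^ 2 * ((y - a) * (b - y)) ^ 2 =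
          2 * ((b - a) - 3 * ((y - a) * (b - y)) / (b - a)) ^ 2 := by
        field_simp
        ring
      have h18 : l = k * (18 / (b - a) ^ 2) := by rw [hl]; ring
      have : 0 ≤ exp (l * r) * k * (2 * ((b - a) - 3 * ((y - a) * (b - y)) / (b - a)) ^ 2) *
          f y r := by positivity
      rw [← hsq] at this
      rw [h18] at this ⊢
      nlinarith
    refine hle.trans (le_of_eq ?_)
    rw [intervalIntegral.integral_const_mul, hgreen, mul_zero]

end IsCaloricOn

theorem hasDerivAt_comp_max_zero {g g' : ℝ → ℝ} (hg : ∀ r, 0 ≤ r → HasDerivAt g (g' r) r)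
    (h0 : g' 0 = 0) (r : ℝ) : HasDerivAt (fun r => g (max r 0)) (g' (max r 0)) r := by
  rcases lt_trichotomy r 0 with h | rfl | h
  · rw [max_eq_right h.le, h0]
    refine (hasDerivAt_const r (g 0)).congr_of_eventuallyEq ?_
    filter_upwards [gt_mem_nhds h] with y hy
    rw [max_eq_right hy.le]
  · have h1 := hg 0 le_rfl
    rw [max_self, h0] at *
    rw [hasDerivAt_iff_isLittleO_nhds_zero] at h1 ⊢
    simp only [zero_add, smul_zero, sub_zero, max_self] at h1 ⊢
    have ht : Tendsto (fun y : ℝ => max y 0) (𝓝 0) (𝓝 0) := by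
      have : Continuous fun y : ℝ => max y 0 := by fun_prop
      simpa using this.tendsto 0
    refine (h1.comp_tendsto ht).trans_isBigO (Asymptotics.IsBigO.of_bound 1 (.of_forall fun y => ?_))
    rw [one_mul, norm_eq_abs, norm_eq_abs, comp_apply, abs_of_nonneg (le_max_right _ _)]
    exact max_le (le_abs_self y) (abs_nonneg y)
  · rw [max_eq_left h.le]
    refine (hg r h.le).congr_of_eventuallyEq ?_
    filter_upwards [lt_mem_nhds h] with y hy
    rw [max_eq_left hy.le]

/-- A `C²` convex function vanishing on the negative half-line and of linear growth. -/
noncomputable def convexPart (r : ℝ) : ℝ := max r 0 ^ 3 / (1 + max r 0) ^ 2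

/-- The derivative of `convexPart`. -/
noncomputable def convexPartDeriv (r : ℝ) : ℝ := max r 0 ^ 2 * (max r 0 + 3) / (1 + max r 0) ^ 3

theorem hasDerivAt_convexPart (r : ℝ) : HasDerivAt convexPart (convexPartDeriv r) r := by
  refine hasDerivAt_comp_max_zero (g := fun m => m ^ 3 / (1 + m) ^ 2)
    (g' := fun m => m ^ 2 * (m + 3) / (1 + m) ^ 3) (fun m hm => ?_) (by simp) r
  have h1 : (1 + m) ≠ 0 := by positivity
  have := ((hasDerivAt_id m).pow 3).div (((hasDerivAt_id m).const_add 1).pow 2)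
    (by simpa using h1)
  refine this.congr_deriv ?_
  simp only [id, Pi.pow_apply]
  field_simp
  norm_num
  ring

theorem hasDerivAt_convexPartDeriv (r : ℝ) :
    HasDerivAt convexPartDeriv (6 * max r 0 / (1 + max r 0) ^ 4) r := by
  refine hasDerivAt_comp_max_zero (g := fun m => m ^ 2 * (m + 3) / (1 + m) ^ 3)
    (g' := fun m => 6 * m / (1 + m) ^ 4) (fun m hm => ?_) (by simp) r
  have h1 : (1 + m) ≠ 0 := by positivity
  have := (((hasDerivAt_id m).pow 2).mul ((hasDerivAt_id m).add_const 3)).div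
    (((hasDerivAt_id m).const_add 1).pow 3) (by simpa using h1)
  refine this.congr_deriv ?_
  simp only [id, Pi.pow_apply, Pi.mul_apply]
  field_simp
  norm_num
  ring

theorem convexPart_of_nonpos {r : ℝ} (hr : r ≤ 0) : convexPart r = 0 := by
  simp [convexPart, max_eq_right hr]

theorem convexPart_nonneg (r : ℝ) : 0 ≤ convexPart r := by
  have : 0 ≤ max r 0 := le_max_right _ _
  unfold convexPart
  positivity

theorem convexPart_pos {r : ℝ} (hr : 0 < r) : 0 < convexPart r := by
  rw [convexPart, max_eq_left hr.le]
  positivity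

theorem convexPart_le (r : ℝ) : convexPart r ≤ max r 0 := by
  have : 0 ≤ max r 0 := le_max_right _ _
  rw [convexPart, div_le_iff₀ (by positivity)]
  nlinarith [mul_nonneg this this]

theorem convexPartDeriv_nonneg (r : ℝ) : 0 ≤ convexPartDeriv r := by
  have : 0 ≤ max r 0 := le_max_right _ _
  unfold convexPartDeriv
  positivity

@[fun_prop]
theorem continuous_convexPart : Continuous convexPart :=
  continuous_iff_continuousAt.2 fun r => (hasDerivAt_convexPart r).continuousAt

@[fun_prop]
theorem continuous_convexPartDeriv : Continuous convexPartDeriv :=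
  continuous_iff_continuousAt.2 fun r => (hasDerivAt_convexPartDeriv r).continuousAt

/-- Maximum principle on a rectangle for subsolutions of the heat equation which may be singular
at the two lower corners, provided that their positive part has bounded mass. -/
theorem nonpos_of_subsolution_of_integral_le {k p q t₁ t C : ℝ} {f fx fxx ft : ℝ → ℝ → ℝ}
    (hk : 0 < k) (hpq : p < q) (ht₁ : t₁ < t)
    (hc : ContinuousOn (uncurry f) (Icc p q ×ˢ Ioc t₁ t))
    (hcx : ContinuousOn (uncurry fx) (Icc p q ×ˢ Ioc t₁ t))
    (hcxx : ContinuousOn (uncurry fxx) (Icc p q ×ˢ Ioc t₁ t))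
    (hct : ContinuousOn (uncurry ft) (Icc p q ×ˢ Ioc t₁ t))
    (hx : ∀ x ∈ Icc p q, ∀ s ∈ Ioc t₁ t, HasDerivAt (fun y => f y s) (fx x s) x)
    (hxx : ∀ x ∈ Icc p q, ∀ s ∈ Ioc t₁ t, HasDerivAt (fun y => fx y s) (fxx x s) x)
    (ht : ∀ x ∈ Icc p q, ∀ s ∈ Ioo t₁ t, HasDerivAt (f x) (ft x s) s)
    (hle : ∀ x ∈ Icc p q, ∀ s ∈ Ioc t₁ t, ft x s ≤ k * fxx x s)
    (hp : ∀ s ∈ Ioc t₁ t, f p s ≤ 0) (hq : ∀ s ∈ Ioc t₁ t, f q s ≤ 0)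
    (hbc : ContinuousOn (uncurry f) (Ioo p q ×ˢ Icc t₁ t))
    (hb : ∀ x ∈ Ioo p q, f x t₁ ≤ 0)
    (hmass : ∀ s ∈ Ioc t₁ t, ∫ y in p..q, max (f y s) 0 ≤ C) :
    ∀ x ∈ Icc p q, f x t ≤ 0 := by
  have hslice : ∀ {g : ℝ → ℝ → ℝ}, ContinuousOn (uncurry g) (Icc p q ×ˢ Ioc t₁ t) →
      ∀ s ∈ Ioc t₁ t, ContinuousOn (fun y => g y s) (Icc p q) := fun hg s hs =>
    hg.comp (f := fun y : ℝ => (y, s)) (by fun_prop) fun y hy => ⟨hy, hs⟩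
  have hψ : ∀ y ∈ Icc p q, 0 ≤ (y - p) * (q - y) := fun y hy =>
    mul_nonneg (sub_nonneg.2 hy.1) (sub_nonneg.2 hy.2)
  have hmono : ∀ s ∈ Ioo t₁ t, ∫ y in p..q, (y - p) * (q - y) * convexPart (f y t) ≤
      ∫ y in p..q, (y - p) * (q - y) * convexPart (f y s) := by
    intro s hs
    have hsub : Icc p q ×ˢ Icc s t ⊆ Icc p q ×ˢ Ioc t₁ t :=
      prod_mono_right fun r hr => ⟨hs.1.trans_le hr.1, hr.2⟩
    have c0 : ContinuousOn (fun z : ℝ × ℝ => f z.1 z.2) (Icc p q ×ˢ Icc s t) := hc.mono hsub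
    have ct : ContinuousOn (fun z : ℝ × ℝ => ft z.1 z.2) (Icc p q ×ˢ Icc s t) := hct.mono hsub
    refine integral_le_integral_of_integral_deriv_nonpos
      (H := fun y r => (y - p) * (q - y) * convexPart (f y r))
      (H' := fun y r => (y - p) * (q - y) * (convexPartDeriv (f y r) * ft y r))
      hpq.le hs.2.le ?_ ?_ (fun y hy r hr => ?_) (fun r hr => ?_)
    · simp only [uncurry_def]
      fun_prop
    · simp only [uncurry_def]
      fun_prop
    · exact ((hasDerivAt_convexPart _).comp r (ht y hy r ⟨hs.1.trans hr.1, hr.2⟩)).const_mul _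
    · have hr' : r ∈ Ioc t₁ t := ⟨hs.1.trans hr.1, hr.2.le⟩
      have d0 := hslice hc r hr'
      have d1 := hslice hcx r hr'
      have d2 := hslice hcxx r hr'
      have dt := hslice hct r hr'
      have hden : ∀ y, (1 + max (f y r) 0) ^ 4 ≠ 0 := fun y => by
        have : 0 ≤ max (f y r) 0 := le_max_right _ _
        positivity
      have d3 : ContinuousOn (fun y => 6 * max (f y r) 0 / (1 + max (f y r) 0) ^ 4) (Icc p q) :=
        ContinuousOn.div (by fun_prop) (by fun_prop) fun y _ => hden y
      have hftc := intervalIntegral.integral_eq_sub_of_hasDerivAt_of_le (a := p) (b := q)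
        (f := fun y => (y - p) * (q - y) * (convexPartDeriv (f y r) * fx y r) -
          (p + q - 2 * y) * convexPart (f y r))
        (f' := fun y => (y - p) * (q - y) * (6 * max (f y r) 0 / (1 + max (f y r) 0) ^ 4 *
          fx y r * fx y r + convexPartDeriv (f y r) * fxx y r) + 2 * convexPart (f y r)) hpq.le
        (by fun_prop) (fun y hy => ?_)
        (ContinuousOn.intervalIntegrable_of_Icc hpq.le (by fun_prop))
      · rw [convexPart_of_nonpos (hp r hr'), convexPart_of_nonpos (hq r hr')] at hftc
        have : ∫ y in p..q, (y - p) * (q - y) * (convexPartDeriv (f y r) * ft y r) ≤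
            ∫ y in p..q, k * ((y - p) * (q - y) * (6 * max (f y r) 0 / (1 + max (f y r) 0) ^ 4 *
          fx y r * fx y r + convexPartDeriv (f y r) * fxx y r) + 2 * convexPart (f y r)) := by
          refine intervalIntegral.integral_mono_on hpq.le
            (ContinuousOn.intervalIntegrable_of_Icc hpq.le (by fun_prop))
            (ContinuousOn.intervalIntegrable_of_Icc hpq.le (by fun_prop)) fun y hy => ?_
          have e1 := mul_le_mul_of_nonneg_left (hle y hy r hr')
            (mul_nonneg (hψ y hy) (convexPartDeriv_nonneg (f y r)))
          have e2 : 0 ≤ 6 * max (f y r) 0 / (1 + max (f y r) 0) ^ 4 := by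
            have : 0 ≤ max (f y r) 0 := le_max_right _ _
            positivity
          have e3 := mul_nonneg hk.le (mul_nonneg (hψ y hy)
            (mul_nonneg e2 (mul_self_nonneg (fx y r))))
          have e4 := mul_nonneg hk.le (convexPart_nonneg (f y r))
          linear_combination e1 + e3 + 2 * e4
        refine this.trans (le_of_eq ?_)
        rw [intervalIntegral.integral_const_mul, hftc]
        ring
      · have hy' := Ioo_subset_Icc_self hy
        have e0 : HasDerivAt (fun y => (y - p) * (q - y)) (p + q - 2 * y) y :=
          (((hasDerivAt_id y).sub_const p).mul ((hasDerivAt_id y).const_sub q)).congr_deriv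
            (by simp only [id]; ring)
        have e1 : HasDerivAt (fun y => p + q - 2 * y) (-2) y :=
          (((hasDerivAt_id y).const_mul 2).const_sub (p + q)).congr_deriv (by ring)
        have e2 := (hasDerivAt_convexPart _).comp y (hx y hy' r hr')
        have e3 := (hasDerivAt_convexPartDeriv _).comp y (hx y hy' r hr')
        exact ((e0.mul (e3.mul (hxx y hy' r hr'))).sub (e1.mul e2)).congr_deriv
          (by simp only [comp_apply, Pi.mul_apply]; ring)
  have hsmall : ∀ ε > 0, ∫ y in p..q, (y - p) * (q - y) * convexPart (f y t) ≤
      ε * (C + (q - p) ^ 3) := by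
    intro ε hε
    set K := {y ∈ Icc p q | ε ≤ (y - p) * (q - y)}
    have hK : IsCompact K := by
      refine isCompact_Icc.of_isClosed_subset ?_ (sep_subset _ _)
      exact isClosed_Icc.inter (isClosed_le (f := fun _ => ε) (g := fun y => (y - p) * (q - y))
        (by fun_prop) (by fun_prop))
    have hKo : ∀ y ∈ K, y ∈ Ioo p q := by
      rintro y ⟨hy, hy'⟩
      refine ⟨lt_of_le_of_ne hy.1 ?_, lt_of_le_of_ne hy.2 ?_⟩ <;> rintro rfl
      · simp only [sub_self, zero_mul] at hy'; linarith
      · simp only [sub_self, mul_zero] at hy'; linarith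
    have hev : ∀ᶠ s in 𝓝 t₁, ∀ y ∈ K, s ∈ Icc t₁ t → f y s ≤ ε := by
      refine hK.eventually_forall_of_forall_eventually fun y hy => ?_
      have h1 := hbc (y, t₁) ⟨hKo y hy, le_rfl, ht₁.le⟩
      have h2 : ∀ᶠ z in 𝓝[Ioo p q ×ˢ Icc t₁ t] (y, t₁), f z.1 z.2 < ε :=
        h1.eventually (gt_mem_nhds (by simpa using (hb y (hKo y hy)).trans_lt hε))
      rw [eventually_nhdsWithin_iff] at h2
      have h3 : ∀ᶠ z : ℝ × ℝ in 𝓝 (y, t₁), z.1 ∈ Ioo p q :=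
        continuous_fst.continuousAt (Ioo_mem_nhds (hKo y hy).1 (hKo y hy).2)
      have h4 : ∀ᶠ z : ℝ × ℝ in 𝓝 (y, t₁), z.2 ∈ Icc t₁ t → f z.1 z.2 ≤ ε := by
        filter_upwards [h2, h3] with z hz hz' hz2 using (hz ⟨hz', hz2⟩).le
      exact (continuous_swap.tendsto (t₁, y)).eventually h4
    obtain ⟨s, hs, hs'⟩ := ((hev.filter_mono nhdsWithin_le_nhds).and (Ioo_mem_nhdsGT ht₁)).exists
    have hsc : s ∈ Ioc t₁ t := Ioo_subset_Ioc_self hs'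
    have d0 := hslice hc s hsc
    calc ∫ y in p..q, (y - p) * (q - y) * convexPart (f y t)
        ≤ ∫ y in p..q, (y - p) * (q - y) * convexPart (f y s) := hmono s hs'
      _ ≤ ∫ y in p..q, (ε * max (f y s) 0 + (q - p) ^ 2 * ε) := by
          refine intervalIntegral.integral_mono_on hpq.le
            (ContinuousOn.intervalIntegrable_of_Icc hpq.le (by fun_prop))
            (ContinuousOn.intervalIntegrable_of_Icc hpq.le (by fun_prop)) fun y hy => ?_
          have hm : 0 ≤ max (f y s) 0 := le_max_right _ _
          have hβ := convexPart_le (f y s)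
          have hβ0 := convexPart_nonneg (f y s)
          by_cases hyK : y ∈ K
          · have h1 : max (f y s) 0 ≤ ε := max_le (hs y hyK (Ioc_subset_Icc_self hsc)) hε.le
            have h2 : (y - p) * (q - y) ≤ (q - p) ^ 2 := by nlinarith [hy.1, hy.2]
            have h3 : (y - p) * (q - y) * convexPart (f y s) ≤ (q - p) ^ 2 * ε :=
              mul_le_mul h2 (hβ.trans h1) hβ0 (sq_nonneg _)
            nlinarith
          · have h1 : (y - p) * (q - y) ≤ ε := le_of_not_ge fun h => hyK ⟨hy, h⟩
            have h3 : (y - p) * (q - y) * convexPart (f y s) ≤ ε * max (f y s) 0 :=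
              mul_le_mul h1 hβ hβ0 hε.le
            have : 0 ≤ (q - p) ^ 2 * ε := by positivity
            linarith
      _ = ε * (∫ y in p..q, max (f y s) 0) + (q - p) * ((q - p) ^ 2 * ε) := by
          rw [intervalIntegral.integral_add
            (ContinuousOn.intervalIntegrable_of_Icc hpq.le (by fun_prop)) (by simp),
            intervalIntegral.integral_const_mul, intervalIntegral.integral_const, smul_eq_mul]
      _ ≤ ε * (C + (q - p) ^ 3) := by
          have := mul_le_mul_of_nonneg_left (hmass s hsc) hε.le
          nlinarith
  have hzero : ∫ y in p..q, (y - p) * (q - y) * convexPart (f y t) ≤ 0 := by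
    have : Tendsto (fun ε : ℝ => ε * (C + (q - p) ^ 3)) (𝓝[>] 0) (𝓝 0) := by
      have h : Continuous fun ε : ℝ => ε * (C + (q - p) ^ 3) := by fun_prop
      simpa using (h.tendsto 0).mono_left nhdsWithin_le_nhds
    exact ge_of_tendsto this (eventually_nhdsWithin_of_forall hsmall)
  have htt : t ∈ Ioc t₁ t := ⟨ht₁, le_rfl⟩
  intro x hxm
  rcases eq_or_lt_of_le hxm.1 with h | h1
  · rw [← h]; exact hp t htt
  rcases eq_or_lt_of_le hxm.2 with h | h2
  · rw [h]; exact hq t htt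
  by_contra! hpos
  have d0 := hslice hc t htt
  refine hzero.not_gt (intervalIntegral.integral_pos hpq (by fun_prop) (fun y hy => ?_)
    ⟨x, hxm, ?_⟩)
  · exact mul_nonneg (hψ y (Ioc_subset_Icc_self hy)) (convexPart_nonneg _)
  · exact mul_pos (mul_pos (sub_pos.2 h1) (sub_pos.2 h2)) (convexPart_pos hpos)

/-- Two-sided form of `nonpos_of_subsolution_of_integral_le`. -/
theorem abs_le_of_subsolution_of_integral_le {k p q t₁ t A N C : ℝ} {f fx fxx ft : ℝ → ℝ → ℝ}
    (hk : 0 < k) (hpq : p < q) (ht₁ : t₁ < t) (hA : 0 ≤ A) (hN : 0 ≤ N)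
    (hc : ContinuousOn (uncurry f) (Icc p q ×ˢ Ioc t₁ t))
    (hcx : ContinuousOn (uncurry fx) (Icc p q ×ˢ Ioc t₁ t))
    (hcxx : ContinuousOn (uncurry fxx) (Icc p q ×ˢ Ioc t₁ t))
    (hct : ContinuousOn (uncurry ft) (Icc p q ×ˢ Ioc t₁ t))
    (hx : ∀ x ∈ Icc p q, ∀ s ∈ Ioc t₁ t, HasDerivAt (fun y => f y s) (fx x s) x)
    (hxx : ∀ x ∈ Icc p q, ∀ s ∈ Ioc t₁ t, HasDerivAt (fun y => fx y s) (fxx x s) x)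
    (ht : ∀ x ∈ Icc p q, ∀ s ∈ Ioo t₁ t, HasDerivAt (f x) (ft x s) s)
    (hle : ∀ x ∈ Icc p q, ∀ s ∈ Ioc t₁ t, |ft x s - k * fxx x s| ≤ N)
    (hp : ∀ s ∈ Ioc t₁ t, |f p s| ≤ A + N * (s - t₁))
    (hq : ∀ s ∈ Ioc t₁ t, |f q s| ≤ A + N * (s - t₁))
    (hbc : ContinuousOn (uncurry f) (Ioo p q ×ˢ Icc t₁ t))
    (hb : ∀ x ∈ Ioo p q, |f x t₁| ≤ A)
    (hmass : ∀ s ∈ Ioc t₁ t, ∫ y in p..q, |f y s| ≤ C) :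
    ∀ x ∈ Icc p q, |f x t| ≤ A + N * (t - t₁) := by
  have key : ∀ σ : ℝ, |σ| = 1 → ∀ x ∈ Icc p q, σ * f x t ≤ A + N * (t - t₁) := by
    intro σ hσ x hxm
    have hab : ∀ r, σ * r ≤ |r| := fun r => (le_abs_self _).trans (by rw [abs_mul, hσ, one_mul])
    have h1 : ContinuousOn (fun z : ℝ × ℝ => f z.1 z.2) (Icc p q ×ˢ Ioc t₁ t) := hc
    have h2 : ContinuousOn (fun z : ℝ × ℝ => fx z.1 z.2) (Icc p q ×ˢ Ioc t₁ t) := hcx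
    have h3 : ContinuousOn (fun z : ℝ × ℝ => fxx z.1 z.2) (Icc p q ×ˢ Ioc t₁ t) := hcxx
    have h4 : ContinuousOn (fun z : ℝ × ℝ => ft z.1 z.2) (Icc p q ×ˢ Ioc t₁ t) := hct
    have h5 : ContinuousOn (fun z : ℝ × ℝ => f z.1 z.2) (Ioo p q ×ˢ Icc t₁ t) := hbc
    have := nonpos_of_subsolution_of_integral_le (C := C) (p := p) (q := q) (t₁ := t₁) (t := t)
      (f := fun y r => σ * f y r - (A + N * (r - t₁))) (fx := fun y r => σ * fx y r)
      (fxx := fun y r => σ * fxx y r) (ft := fun y r => σ * ft y r - N) hk hpq ht₁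
      (by simp only [uncurry_def]; fun_prop) (by simp only [uncurry_def]; fun_prop)
      (by simp only [uncurry_def]; fun_prop) (by simp only [uncurry_def]; fun_prop)
      (fun y hy s hs => ((hx y hy s hs).const_mul σ).sub_const _)
      (fun y hy s hs => (hxx y hy s hs).const_mul σ) (fun y hy s hs => ?_)
      (fun y hy s hs => ?_) (fun s hs => ?_) (fun s hs => ?_)
      (by simp only [uncurry_def]; fun_prop) (fun y hy => ?_) (fun s hs => ?_) x hxm
    · linarith
    · exact (((ht y hy s hs).const_mul σ).sub ((((hasDerivAt_id s).sub_const t₁).const_mul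
        N).const_add A)).congr_deriv (by ring)
    · have := (hab (ft y s - k * fxx y s)).trans (hle y hy s hs)
      linarith
    · have := (hab _).trans (hp s hs)
      linarith
    · have := (hab _).trans (hq s hs)
      linarith
    · have := (hab _).trans (hb y hy)
      linarith
    · have h6 : ContinuousOn (fun y => f y s) (Icc p q) :=
        hc.comp (f := fun y : ℝ => (y, s)) (by fun_prop) fun y hy => ⟨hy, hs⟩
      refine le_trans ?_ (hmass s hs)
      refine intervalIntegral.integral_mono_on hpq.le
        (ContinuousOn.intervalIntegrable_of_Icc hpq.le (by fun_prop))
        (ContinuousOn.intervalIntegrable_of_Icc hpq.le (by fun_prop)) fun y hy => ?_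
      refine max_le ?_ (abs_nonneg _)
      have := mul_nonneg hN (sub_nonneg.2 hs.1.le)
      linarith [hab (f y s)]
  intro x hxm
  have h1 := key 1 (by simp) x hxm
  have h2 := key (-1) (by simp) x hxm
  exact abs_le.2 ⟨by linarith, by linarith⟩

/-- The local mass of a nonnegative solution on a half-open time strip is bounded. -/
theorem exists_forall_integral_le {k y₁ y₂ t₁ t p q : ℝ} {u ux uxx : ℝ → ℝ → ℝ} (hk : 0 < k)
    (hu : ∀ s ∈ Ioo t₁ t, IsCaloricOn k u ux uxx y₁ y₂ s t)
    (hpos : ∀ x ∈ Icc y₁ y₂, ∀ s ∈ Ioc t₁ t, 0 ≤ u x s) (hp : y₁ < p) (hpq : p < q)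
    (hq : q < y₂) : ∃ C, ∀ s ∈ Ioc t₁ t, ∫ y in p..q, u y s ≤ C := by
  obtain ⟨a, ha1, ha2⟩ := exists_between hp
  obtain ⟨b, hb1, hb2⟩ := exists_between hq
  have hab : a < b := by linarith
  set l := 18 * k / (b - a) ^ 2
  have hl : 0 ≤ l := by positivity
  set m := ((p - a) * (b - q)) ^ 2
  have hm : 0 < m := pow_pos (mul_pos (sub_pos.2 ha2) (sub_pos.2 hb1)) 2
  refine ⟨m⁻¹ * ((exp (l * t₁))⁻¹ *
    (exp (l * t) * ∫ y in a..b, ((y - a) * (b - y)) ^ 2 * u y t)), fun s hs => ?_⟩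
  obtain ⟨r, hr1, hr2⟩ := exists_between hs.1
  have hcal := hu r ⟨hr1, hr2.trans_le hs.2⟩
  have hnn : ∀ y ∈ Icc y₁ y₂, 0 ≤ u y s := fun y hy => hpos y hy s hs
  have h1 := hcal.integral_bump_mul_le hk
    (fun x hx r' hr' => hpos x hx r' ⟨hr1.trans_le hr'.1, hr'.2⟩) ha1 hab hb2 ⟨hr2, hs.2⟩
  have hc : ContinuousOn (fun y => u y s) (Icc y₁ y₂) :=
    hcal.continuousOn.comp (f := fun y : ℝ => (y, s)) (by fun_prop)
      fun y hy => ⟨hy, hr2.le, hs.2⟩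
  have hc1 : ContinuousOn (fun y => u y s) (Icc p q) := hc.mono (Icc_subset_Icc hp.le hq.le)
  have hc2 : ContinuousOn (fun y => u y s) (Icc a b) := hc.mono (Icc_subset_Icc ha1.le hb2.le)
  have hn2 : ∀ y ∈ Icc a b, 0 ≤ u y s := fun y hy => hnn y (Icc_subset_Icc ha1.le hb2.le hy)
  have h2 : m * ∫ y in p..q, u y s ≤ ∫ y in p..q, ((y - a) * (b - y)) ^ 2 * u y s := by
    rw [← intervalIntegral.integral_const_mul]
    refine intervalIntegral.integral_mono_on hpq.le
      (ContinuousOn.intervalIntegrable_of_Icc hpq.le (by fun_prop))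
      (ContinuousOn.intervalIntegrable_of_Icc hpq.le (by fun_prop)) fun y hy => ?_
    refine mul_le_mul_of_nonneg_right ?_ (hnn y (Icc_subset_Icc hp.le hq.le hy))
    have e1 : 0 ≤ p - a := by linarith
    have e2 : 0 ≤ b - q := by linarith
    refine pow_le_pow_left₀ (mul_nonneg e1 e2) ?_ 2
    exact mul_le_mul (by linarith [hy.1]) (by linarith [hy.2]) e2 (by linarith [hy.1])
  have h3 : ∫ y in p..q, ((y - a) * (b - y)) ^ 2 * u y s ≤
      ∫ y in a..b, ((y - a) * (b - y)) ^ 2 * u y s := by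
    refine intervalIntegral.integral_mono_interval ha2.le hpq.le hb1.le ?_
      (ContinuousOn.intervalIntegrable_of_Icc hab.le (by fun_prop))
    rw [EventuallyLE, ae_restrict_iff' measurableSet_Ioc]
    exact .of_forall fun y hy =>
      mul_nonneg (sq_nonneg _) (hn2 y (Ioc_subset_Icc_self hy))
  have h4 : exp (l * t₁) * ∫ y in a..b, ((y - a) * (b - y)) ^ 2 * u y s ≤
      exp (l * s) * ∫ y in a..b, ((y - a) * (b - y)) ^ 2 * u y s := by
    refine mul_le_mul_of_nonneg_right (exp_le_exp.2 (mul_le_mul_of_nonneg_left hs.1.le hl)) ?_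
    exact intervalIntegral.integral_nonneg hab.le fun y hy => mul_nonneg (sq_nonneg _) (hn2 y hy)
  rw [le_inv_mul_iff₀ hm, le_inv_mul_iff₀ (exp_pos _)]
  exact (mul_le_mul_of_nonneg_left (h2.trans h3) (exp_pos _).le).trans (h4.trans h1)

/-- If the time derivative of a positive solution is bounded at the bottom and on the sides of a
rectangle then it is bounded by the same constant at the top, even when the solution is not known
to be continuous at the bottom corners. -/
theorem abs_le_of_isCaloricOn_strip {k y₁ y₂ t₁ t p q N : ℝ} {u ux uxx : ℝ → ℝ → ℝ} (hk : 0 < k)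
    (ht₁ : t₁ < t) (hu : ∀ s ∈ Ioo t₁ t, IsCaloricOn k u ux uxx y₁ y₂ s t)
    (hpos : ∀ x ∈ Icc y₁ y₂, ∀ s ∈ Icc t₁ t, 0 ≤ u x s) (hp : y₁ < p) (hpq : p < q)
    (hq : q < y₂) (hbc : ContinuousOn (uncurry u) (Ioo p q ×ˢ Icc t₁ t))
    (hux : ∀ x ∈ Icc p q, HasDerivAt (fun y => u y t₁) (ux x t₁) x)
    (huxx : ∀ x ∈ Icc p q, HasDerivAt (fun y => ux y t₁) (uxx x t₁) x)
    (hcxx : ContinuousOn (fun x => uxx x t₁) (Icc p q))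
    (hut : ∀ x ∈ Icc p q, ∀ s ∈ Icc t₁ t, HasDerivWithinAt (u x) (k * uxx x s) (Icc t₁ t) s)
    (hNp : ∀ s ∈ Icc t₁ t, |k * uxx p s| ≤ N) (hNq : ∀ s ∈ Icc t₁ t, |k * uxx q s| ≤ N)
    (hNb : ∀ x ∈ Icc p q, |k * uxx x t₁| ≤ N) :
    ∀ x ∈ Icc p q, |k * uxx x t| ≤ N := by
  have hN : 0 ≤ N := (abs_nonneg _).trans (hNp t₁ ⟨le_rfl, ht₁.le⟩)
  obtain ⟨C, hC⟩ := exists_forall_integral_le hk hu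
    (fun x hx s hs => hpos x hx s (Ioc_subset_Icc_self hs)) hp hpq hq
  have hside : ∀ x ∈ Icc p q, (∀ s ∈ Icc t₁ t, |k * uxx x s| ≤ N) →
      ∀ s ∈ Icc t₁ t, ∀ r ∈ Icc t₁ t, |u x r - u x s| ≤ N * |r - s| := fun x hx hxN s hs r hr =>
    (convex_Icc t₁ t).norm_image_sub_le_of_norm_hasDerivWithin_le (hut x hx) hxN hs hr
  have hpm : p ∈ Icc p q := ⟨le_rfl, hpq.le⟩
  have hqm : q ∈ Icc p q := ⟨hpq.le, le_rfl⟩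
  have hsub : Icc p q ⊆ Icc y₁ y₂ := Icc_subset_Icc hp.le hq.le
  have hIoo : ∀ x ∈ Icc p q, x ∈ Ioo y₁ y₂ := fun x hx => ⟨hp.trans_le hx.1, hx.2.trans_lt hq⟩
  have hcont : ∀ {g : ℝ → ℝ → ℝ}, (∀ s ∈ Ioo t₁ t, ContinuousOn (uncurry g) (Icc p q ×ˢ Icc s t)) →
      ContinuousOn (fun z : ℝ × ℝ => g z.1 z.2) (Icc p q ×ˢ Ioc t₁ t) := by
    rintro g hg ⟨x, s⟩ ⟨hx, hs⟩
    obtain ⟨r, hr1, hr2⟩ := exists_between hs.1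
    refine (hg r ⟨hr1, hr2.trans_le hs.2⟩ (x, s) ⟨hx, hr2.le, hs.2⟩).mono_of_mem_nhdsWithin ?_
    have : {z : ℝ × ℝ | r < z.2} ∈ 𝓝 (x, s) :=
      (isOpen_lt continuous_const continuous_snd).mem_nhds hr2
    filter_upwards [nhdsWithin_le_nhds this, self_mem_nhdsWithin] with z hz1 hz2
    exact ⟨hz2.1, (show r < z.2 from hz1).le, hz2.2.2⟩
  have c0 : ContinuousOn (fun z : ℝ × ℝ => u z.1 z.2) (Icc p q ×ˢ Ioc t₁ t) :=
    hcont fun s hs => (hu s hs).continuousOn.mono (prod_mono_left hsub)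
  have c1 : ContinuousOn (fun z : ℝ × ℝ => ux z.1 z.2) (Icc p q ×ˢ Ioc t₁ t) := by
    refine hcont fun s hs => ?_
    obtain ⟨r, hr1, hr2⟩ := exists_between hs.1
    exact (hu r ⟨hr1, hr2.trans hs.2⟩).continuousOn_fx hk hp hq hr2
  have c2 : ContinuousOn (fun z : ℝ × ℝ => uxx z.1 z.2) (Icc p q ×ˢ Ioc t₁ t) := by
    refine hcont fun s hs => ?_
    obtain ⟨r, hr1, hr2⟩ := exists_between hs.1
    exact (hu r ⟨hr1, hr2.trans hs.2⟩).continuousOn_fxx hk hp hq hr2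
  have b0 : ContinuousOn (fun y => u y t₁) (Icc p q) := fun x hx =>
    (hux x hx).continuousAt.continuousWithinAt
  have b1 : ContinuousOn (fun y => ux y t₁) (Icc p q) := fun x hx =>
    (huxx x hx).continuousAt.continuousWithinAt
  have hslice : ∀ s ∈ Ioc t₁ t, ContinuousOn (fun y => u y s) (Icc p q) := fun s hs =>
    c0.comp (f := fun y : ℝ => (y, s)) (by fun_prop) fun y hy => ⟨hy, hs⟩
  have dx : ∀ x ∈ Icc p q, ∀ s ∈ Ioc t₁ t, HasDerivAt (fun y => u y s) (ux x s) x := by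
    intro x hx s hs
    obtain ⟨r, hr1, hr2⟩ := exists_between hs.1
    exact (hu r ⟨hr1, hr2.trans_le hs.2⟩).hasDerivAt x (hIoo x hx) s ⟨hr2, hs.2⟩
  have dxx : ∀ x ∈ Icc p q, ∀ s ∈ Ioc t₁ t, HasDerivAt (fun y => ux y s) (uxx x s) x := by
    intro x hx s hs
    obtain ⟨r, hr1, hr2⟩ := exists_between hs.1
    exact (hu r ⟨hr1, hr2.trans_le hs.2⟩).hasDerivAt_fx x (hIoo x hx) s ⟨hr2, hs.2⟩
  have dt : ∀ x ∈ Icc p q, ∀ s ∈ Ioo t₁ t, HasDerivAt (u x) (k * uxx x s) s := fun x hx s hs =>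
    (hut x hx s (Ioo_subset_Icc_self hs)).hasDerivAt (Icc_mem_nhds hs.1 hs.2)
  have hb5 : ContinuousOn (fun z : ℝ × ℝ => u z.1 z.2) (Ioo p q ×ˢ Icc t₁ t) := hbc
  have hfirst : ∀ s ∈ Ioc t₁ t, ∀ x ∈ Icc p q, |u x s - u x t₁| ≤ N * (s - t₁) := by
    intro s hs x hx
    have hss : Ioc t₁ s ⊆ Ioc t₁ t := Ioc_subset_Ioc_right hs.2
    have e0 := c0.mono (prod_mono_right hss)
    have e1 := c1.mono (prod_mono_right hss)
    have e2 := c2.mono (prod_mono_right hss)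
    have g0 : ContinuousOn (fun z : ℝ × ℝ => u z.1 t₁) (Icc p q ×ˢ Ioc t₁ s) :=
      b0.comp continuousOn_fst fun z hz => hz.1
    have g1 : ContinuousOn (fun z : ℝ × ℝ => ux z.1 t₁) (Icc p q ×ˢ Ioc t₁ s) :=
      b1.comp continuousOn_fst fun z hz => hz.1
    have g2 : ContinuousOn (fun z : ℝ × ℝ => uxx z.1 t₁) (Icc p q ×ˢ Ioc t₁ s) :=
      hcxx.comp continuousOn_fst fun z hz => hz.1
    have g4 : ContinuousOn (fun z : ℝ × ℝ => u z.1 t₁) (Ioo p q ×ˢ Icc t₁ s) :=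
      b0.comp continuousOn_fst fun z hz => Ioo_subset_Icc_self hz.1
    have g5 := hb5.mono (prod_mono_right (Icc_subset_Icc_right hs.2) :
      Ioo p q ×ˢ Icc t₁ s ⊆ _)
    have hss' : ∀ r ∈ Ioc t₁ s, r ∈ Icc t₁ t := fun r hr => Ioc_subset_Icc_self (hss hr)
    have := abs_le_of_subsolution_of_integral_le (C := C + ∫ y in p..q, u y t₁) (p := p)
      (q := q) (t₁ := t₁) (t := s) (A := 0) (N := N) (f := fun y r => u y r - u y t₁)
      (fx := fun y r => ux y r - ux y t₁)
      (fxx := fun y r => uxx y r - uxx y t₁) (ft := fun y r => k * uxx y r) hk hpq hs.1 le_rfl hN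
      (e0.sub g0) (e1.sub g1)
      (e2.sub g2) (e2.const_mul k)
      (fun y hy r hr => (dx y hy r (hss hr)).sub (hux y hy))
      (fun y hy r hr => (dxx y hy r (hss hr)).sub (huxx y hy))
      (fun y hy r hr => (dt y hy r ⟨hr.1, hr.2.trans_le hs.2⟩).sub_const _)
      (fun y hy r hr => ?_) (fun r hr => ?_) (fun r hr => ?_)
      (g5.sub g4) (fun y hy => by simp) (fun r hr => ?_) x hx
    · simpa using this
    · rw [mul_sub, sub_sub_cancel]; exact hNb y hy
    · have := hside p hpm hNp t₁ ⟨le_rfl, ht₁.le⟩ r (hss' r hr)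
      rwa [abs_of_nonneg (sub_nonneg.2 hr.1.le), ← zero_add (N * _)] at this
    · have := hside q hqm hNq t₁ ⟨le_rfl, ht₁.le⟩ r (hss' r hr)
      rwa [abs_of_nonneg (sub_nonneg.2 hr.1.le), ← zero_add (N * _)] at this
    · have h1 := hslice r (hss hr)
      calc ∫ y in p..q, |u y r - u y t₁| ≤ ∫ y in p..q, (u y r + u y t₁) := by
            refine intervalIntegral.integral_mono_on hpq.le
              (ContinuousOn.intervalIntegrable_of_Icc hpq.le (by fun_prop))
              (ContinuousOn.intervalIntegrable_of_Icc hpq.le (by fun_prop)) fun y hy => ?_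
            have i1 := hpos y (hsub hy) r (hss' r hr)
            have i2 := hpos y (hsub hy) t₁ ⟨le_rfl, ht₁.le⟩
            exact abs_le.2 ⟨by linarith, by linarith⟩
        _ = (∫ y in p..q, u y r) + ∫ y in p..q, u y t₁ :=
            intervalIntegral.integral_add
              (ContinuousOn.intervalIntegrable_of_Icc hpq.le (by fun_prop))
              (ContinuousOn.intervalIntegrable_of_Icc hpq.le (by fun_prop))
        _ ≤ _ := by linarith [hC r (hss hr)]
  have hlip : ∀ r ∈ Ioo t₁ t, ∀ x ∈ Icc p q, |u x t - u x r| ≤ N * (t - r) := by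
    intro r₀ hr₀ x hx
    set h := t - r₀ with hh
    have hh0 : 0 < h := sub_pos.2 hr₀.2
    have hm1 : ∀ r ∈ Ioc t₁ r₀, r ∈ Ioc t₁ t := fun r hr => ⟨hr.1, hr.2.trans hr₀.2.le⟩
    have hm2 : ∀ r ∈ Icc t₁ r₀, r + h ∈ Ioc t₁ t := fun r hr =>
      ⟨by linarith [hr.1], by linarith [hr.2]⟩
    have hm3 : ∀ r ∈ Ioc t₁ r₀, r + h ∈ Ioc t₁ t := fun r hr => hm2 r (Ioc_subset_Icc_self hr)
    have e0 := c0.mono (prod_mono_right hm1)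
    have e1 := c1.mono (prod_mono_right hm1)
    have e2 := c2.mono (prod_mono_right hm1)
    have g0 : ContinuousOn (fun z : ℝ × ℝ => u z.1 (z.2 + h)) (Icc p q ×ˢ Ioc t₁ r₀) :=
      c0.comp (f := fun z : ℝ × ℝ => (z.1, z.2 + h)) (by fun_prop) fun z hz => ⟨hz.1, hm3 _ hz.2⟩
    have g1 : ContinuousOn (fun z : ℝ × ℝ => ux z.1 (z.2 + h)) (Icc p q ×ˢ Ioc t₁ r₀) :=
      c1.comp (f := fun z : ℝ × ℝ => (z.1, z.2 + h)) (by fun_prop) fun z hz => ⟨hz.1, hm3 _ hz.2⟩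
    have g2 : ContinuousOn (fun z : ℝ × ℝ => uxx z.1 (z.2 + h)) (Icc p q ×ˢ Ioc t₁ r₀) :=
      c2.comp (f := fun z : ℝ × ℝ => (z.1, z.2 + h)) (by fun_prop) fun z hz => ⟨hz.1, hm3 _ hz.2⟩
    have g4 : ContinuousOn (fun z : ℝ × ℝ => u z.1 (z.2 + h)) (Ioo p q ×ˢ Icc t₁ r₀) :=
      c0.comp (f := fun z : ℝ × ℝ => (z.1, z.2 + h)) (by fun_prop)
        fun z hz => ⟨Ioo_subset_Icc_self hz.1, hm2 _ hz.2⟩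
    have g5 := hb5.mono (prod_mono_right (Icc_subset_Icc_right hr₀.2.le) :
      Ioo p q ×ˢ Icc t₁ r₀ ⊆ _)
    have hsides : ∀ x ∈ Icc p q, (∀ s ∈ Icc t₁ t, |k * uxx x s| ≤ N) → ∀ s ∈ Ioc t₁ r₀,
        |u x (s + h) - u x s| ≤ N * h + 0 * (s - t₁) := fun x hx hxN s hs => by
      have := hside x hx hxN s (Ioc_subset_Icc_self (hm1 s hs)) (s + h)
        (Ioc_subset_Icc_self (hm3 s hs))
      rw [add_sub_cancel_left, abs_of_pos hh0] at this
      linarith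
    have := abs_le_of_subsolution_of_integral_le (C := C + C) (p := p)
      (q := q) (t₁ := t₁) (t := r₀) (A := N * h) (N := 0) (f := fun y r => u y (r + h) - u y r)
      (fx := fun y r => ux y (r + h) - ux y r)
      (fxx := fun y r => uxx y (r + h) - uxx y r)
      (ft := fun y r => k * uxx y (r + h) - k * uxx y r) hk hpq hr₀.1 (by positivity) le_rfl
      (g0.sub e0) (g1.sub e1)
      (g2.sub e2) ((g2.const_mul k).sub (e2.const_mul k))
      (fun y hy r hr => (dx y hy _ (hm3 r hr)).sub (dx y hy r (hm1 r hr)))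
      (fun y hy r hr => (dxx y hy _ (hm3 r hr)).sub (dxx y hy r (hm1 r hr)))
      (fun y hy r hr => ?_)
      (fun y hy r hr => by rw [mul_sub, sub_self, abs_zero]) (hsides p hpm hNp) (hsides q hqm hNq)
      (g4.sub g5) (fun y hy => ?_) (fun r hr => ?_) x hx
    · simpa [hh] using this
    · refine HasDerivAt.sub ?_ (dt y hy r ⟨hr.1, hr.2.trans hr₀.2⟩)
      exact (dt y hy (r + h) ⟨by linarith [hr.1], by linarith [hr.2]⟩).comp_add_const r h
    · have := hfirst (t₁ + h) (hm2 t₁ ⟨le_rfl, hr₀.1.le⟩) y (Ioo_subset_Icc_self hy)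
      rwa [add_sub_cancel_left] at this
    · have h1 := hslice r (hm1 r hr)
      have h2 := hslice _ (hm3 r hr)
      calc ∫ y in p..q, |u y (r + h) - u y r| ≤ ∫ y in p..q, (u y (r + h) + u y r) := by
            refine intervalIntegral.integral_mono_on hpq.le
              (ContinuousOn.intervalIntegrable_of_Icc hpq.le (by fun_prop))
              (ContinuousOn.intervalIntegrable_of_Icc hpq.le (by fun_prop)) fun y hy => ?_
            have i1 := hpos y (hsub hy) r (Ioc_subset_Icc_self (hm1 r hr))
            have i2 := hpos y (hsub hy) _ (Ioc_subset_Icc_self (hm3 r hr))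
            exact abs_le.2 ⟨by linarith, by linarith⟩
        _ = (∫ y in p..q, u y (r + h)) + ∫ y in p..q, u y r :=
            intervalIntegral.integral_add
              (ContinuousOn.intervalIntegrable_of_Icc hpq.le (by fun_prop))
              (ContinuousOn.intervalIntegrable_of_Icc hpq.le (by fun_prop))
        _ ≤ _ := by linarith [hC r (hm1 r hr), hC _ (hm3 r hr)]
  intro x hx
  have hd := hut x hx t ⟨ht₁.le, le_rfl⟩
  rw [hasDerivWithinAt_iff_tendsto_slope, Icc_sdiff_right] at hd
  have hne : (𝓝[Ico t₁ t] t).NeBot := right_nhdsWithin_Ico_neBot ht₁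
  refine le_of_tendsto hd.abs (eventually_nhdsWithin_of_forall fun r hr => ?_)
  have hr' : |u x t - u x r| ≤ N * (t - r) := by
    rcases eq_or_lt_of_le hr.1 with rfl | h
    · exact hfirst t ⟨ht₁, le_rfl⟩ x hx
    · exact hlip r ⟨h, hr.2⟩ x hx
  rw [slope_def_field, abs_div, abs_sub_comm, abs_sub_comm r, abs_of_pos (sub_pos.2 hr.2),
    div_le_iff₀ (sub_pos.2 hr.2)]
  exact hr'

/-- A separately continuous function is locally bounded along horizontal and vertical lines through
a portion of any nonempty locally closed set. -/
theorem exists_forall_le_of_separately_continuousOn {I J : Set ℝ} {g : ℝ → ℝ → ℝ}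
    (hx : ∀ t ∈ J, ContinuousOn (fun x => g x t) I) (ht : ∀ x ∈ I, ContinuousOn (g x) J)
    {S : Set (ℝ × ℝ)} (hSI : S ⊆ I ×ˢ J) (hS : IsLocallyClosed S) (hne : S.Nonempty) :
    ∃ z₀ ∈ S, ∃ r > 0, ∃ N, ∀ z ∈ S, |z.1 - z₀.1| < r → |z.2 - z₀.2| < r →
      (∀ x ∈ I, |x - z₀.1| < r → g x z.2 ≤ N) ∧ (∀ t ∈ J, |t - z₀.2| < r → g z.1 t ≤ N) := by
  have := hS.locallyCompactSpace
  have : Nonempty S := hne.to_subtype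
  set F : ℕ → Set S := fun n =>
    (⋂ x ∈ I, {z : S | |x - z.1.1| < 1 / (n + 1) → g x z.1.2 ≤ n}) ∩
      ⋂ t ∈ J, {z : S | |t - z.1.2| < 1 / (n + 1) → g z.1.1 t ≤ n} with hF
  have hFc : ∀ n, IsClosed (F n) := by
    refine fun n => (isClosed_biInter fun x hxI => ?_).inter (isClosed_biInter fun t htJ => ?_)
    · refine isClosed_imp (isOpen_lt (by fun_prop) continuous_const)
        (isClosed_le ?_ continuous_const)
      exact (ht x hxI).comp_continuous (f := fun z : S => z.1.2) (by fun_prop)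
        fun z => (hSI z.2).2
    · refine isClosed_imp (isOpen_lt (by fun_prop) continuous_const)
        (isClosed_le ?_ continuous_const)
      exact (hx t htJ).comp_continuous (f := fun z : S => z.1.1) (by fun_prop)
        fun z => (hSI z.2).1
  have hbd : ∀ {A : Set ℝ} {φ : ℝ → ℝ} {x : ℝ}, ContinuousOn φ A → x ∈ A → ∃ δ > 0, ∃ M,
      ∀ y ∈ A, |y - x| < δ → φ y ≤ M := by
    intro A φ x hφ hxA
    have h1 : ∀ᶠ y in 𝓝[A] x, φ y < φ x + 1 := (hφ x hxA).eventually (gt_mem_nhds (by linarith))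
    obtain ⟨δ, hδ, h⟩ := Metric.mem_nhdsWithin_iff.1 h1
    exact ⟨δ, hδ, φ x + 1, fun y hy hyx => (h ⟨by simpa [Real.dist_eq] using hyx, hy⟩).le⟩
  have hFU : ⋃ n, F n = univ := by
    refine eq_univ_of_forall fun z => mem_iUnion.2 ?_
    obtain ⟨δ₁, hδ₁, M₁, h₁⟩ := hbd (hx _ (hSI z.2).2) (hSI z.2).1
    obtain ⟨δ₂, hδ₂, M₂, h₂⟩ := hbd (ht _ (hSI z.2).1) (hSI z.2).2
    obtain ⟨n₀, hn₀⟩ := exists_nat_one_div_lt (lt_min hδ₁ hδ₂)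
    obtain ⟨n₁, hn₁⟩ := exists_nat_ge (max M₁ M₂)
    have hd : (1 : ℝ) / ((max n₀ n₁ : ℕ) + 1) < min δ₁ δ₂ := by
      refine lt_of_le_of_lt (one_div_le_one_div_of_le (by positivity) ?_) hn₀
      have : (n₀ : ℝ) ≤ (max n₀ n₁ : ℕ) := Nat.cast_le.2 (le_max_left _ _)
      linarith
    have hM : max M₁ M₂ ≤ ((max n₀ n₁ : ℕ) : ℝ) := hn₁.trans (Nat.cast_le.2 (le_max_right _ _))
    refine ⟨max n₀ n₁, mem_iInter₂.2 fun x hxI hlt => ?_, mem_iInter₂.2 fun t htJ hlt => ?_⟩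
    · exact (h₁ x hxI (hlt.trans (hd.trans_le (min_le_left _ _)))).trans
        ((le_max_left _ _).trans hM)
    · exact (h₂ t htJ (hlt.trans (hd.trans_le (min_le_right _ _)))).trans
        ((le_max_right _ _).trans hM)
  obtain ⟨n, z₀, hz₀⟩ := nonempty_interior_of_iUnion_of_closed hFc hFU
  obtain ⟨ε, hε, hball⟩ := Metric.isOpen_iff.1 isOpen_interior z₀ hz₀
  have hn : (0 : ℝ) < 1 / (n + 1) := by positivity
  refine ⟨z₀, z₀.2, min ε (1 / (n + 1) / 2), lt_min hε (half_pos hn), n, fun z hz h1 h2 => ?_⟩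
  have hzF : (⟨z, hz⟩ : S) ∈ F n := by
    refine interior_subset (hball ?_)
    rw [Metric.mem_ball, Subtype.dist_eq, Prod.dist_eq]
    exact max_lt (h1.trans_le (min_le_left _ _)) (h2.trans_le (min_le_left _ _))
  have htri : ∀ {x y c : ℝ}, |x - c| < min ε (1 / (n + 1) / 2) →
      |y - c| < min ε (1 / (n + 1) / 2) → |x - y| < 1 / (n + 1) := by
    intro x y c h1 h2
    have h1 := h1.trans_le (min_le_right _ _)
    have h2 := h2.trans_le (min_le_right _ _)
    have := abs_sub_le x c y
    rw [abs_sub_comm c y] at this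
    linarith
  exact ⟨fun x hxI hlt => mem_iInter₂.1 hzF.1 x hxI (htri hlt h1),
    fun t htJ hlt => mem_iInter₂.1 hzF.2 t htJ (htri hlt h2)⟩

/-- `u` is a positive solution of `u_t = k u_xx` on `(l₁, l₂) × (0, T]`, with spatial derivatives
`ux` and `uxx`, and `uxx` is separately continuous. -/
structure IsSeparatelyCaloric (k : ℝ) (u ux uxx : ℝ → ℝ → ℝ) (l₁ l₂ T : ℝ) : Prop where
  pos : ∀ x ∈ Ioo l₁ l₂, ∀ t ∈ Ioc 0 T, 0 < u x t
  hasDerivAt : ∀ x ∈ Ioo l₁ l₂, ∀ t ∈ Ioc 0 T, HasDerivAt (fun y => u y t) (ux x t) x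
  hasDerivAt_ux : ∀ x ∈ Ioo l₁ l₂, ∀ t ∈ Ioc 0 T, HasDerivAt (fun y => ux y t) (uxx x t) x
  hasDerivWithinAt : ∀ x ∈ Ioo l₁ l₂, ∀ t ∈ Ioc 0 T,
    HasDerivWithinAt (u x) (k * uxx x t) (Icc 0 T) t
  continuousOn_space : ∀ t ∈ Ioc 0 T, ContinuousOn (fun x => uxx x t) (Ioo l₁ l₂)
  continuousOn_time : ∀ x ∈ Ioo l₁ l₂, ContinuousOn (uxx x) (Ioc 0 T)

namespace IsSeparatelyCaloric

variable {k l₁ l₂ T : ℝ} {u ux uxx : ℝ → ℝ → ℝ}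

theorem isCaloricOn (hu : IsSeparatelyCaloric k u ux uxx l₁ l₂ T) {y₁ y₂ s₁ s₂ : ℝ}
    (h1 : l₁ ≤ y₁) (h2 : y₂ ≤ l₂) (h3 : 0 ≤ s₁) (h4 : s₂ ≤ T)
    (hc : ContinuousOn (uncurry u) (Icc y₁ y₂ ×ˢ Icc s₁ s₂)) :
    IsCaloricOn k u ux uxx y₁ y₂ s₁ s₂ where
  continuousOn := hc
  hasDerivAt x hx t ht := hu.hasDerivAt x (Ioo_subset_Ioo h1 h2 hx) t (Ioc_subset_Ioc h3 h4 ht)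
  hasDerivAt_fx x hx t ht :=
    hu.hasDerivAt_ux x (Ioo_subset_Ioo h1 h2 hx) t (Ioc_subset_Ioc h3 h4 ht)
  hasDerivWithinAt x hx t ht :=
    (hu.hasDerivWithinAt x (Ioo_subset_Ioo h1 h2 hx) t (Ioc_subset_Ioc h3 h4 ht)).mono
      (Icc_subset_Icc h3 h4)

/-- If discontinuities of `u` inside a rectangle project into `X` and `V`, a bound for the time
derivative on the lines through `X` and `V` holds on the whole rectangle. -/
theorem abs_le_of_isClosed (hu : IsSeparatelyCaloric k u ux uxx l₁ l₂ T) (hk : 0 < k)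
    {y₁ p₁ p₂ y₂ τ₁ τ₂ N : ℝ} (hy₁ : l₁ < y₁) (hp₁ : y₁ < p₁) (hp₂ : p₂ < y₂) (hy₂ : y₂ < l₂)
    (hτ₁ : 0 < τ₁) (hτ₂ : τ₂ ≤ T) {X V : Set ℝ} (hX : IsClosed X) (hV : IsClosed V)
    (hp₁X : p₁ ∈ X) (hp₂X : p₂ ∈ X) (hτV : τ₁ ∈ V)
    (hXN : ∀ x ∈ X, x ∈ Icc p₁ p₂ → ∀ s ∈ Icc τ₁ τ₂, |k * uxx x s| ≤ N)
    (hVN : ∀ s ∈ V, s ∈ Icc τ₁ τ₂ → ∀ x ∈ Icc p₁ p₂, |k * uxx x s| ≤ N)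
    (hG : ∀ x ∈ Icc y₁ y₂, ∀ s ∈ Icc τ₁ τ₂, (x ∉ X ∨ s ∉ V) →
      ContinuousWithinAt (uncurry u) (Ioo l₁ l₂ ×ˢ Ioc 0 T) (x, s)) :
    ∀ x ∈ Icc p₁ p₂, ∀ t ∈ Icc τ₁ τ₂, |k * uxx x t| ≤ N := by
  intro x hx t ht
  by_cases hxX : x ∈ X
  · exact hXN x hxX hx t ht
  by_cases htV : t ∈ V
  · exact hVN t htV ht x hx
  obtain ⟨t₁, ⟨ht₁V, ht₁⟩, ht₁max⟩ :=
    ((isCompact_Icc (a := τ₁) (b := t)).inter_left hV).exists_isGreatest ⟨τ₁, hτV, le_rfl, ht.1⟩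
  obtain ⟨p, ⟨hpX, hp⟩, hpmax⟩ :=
    ((isCompact_Icc (a := p₁) (b := x)).inter_left hX).exists_isGreatest ⟨p₁, hp₁X, le_rfl, hx.1⟩
  obtain ⟨q, ⟨hqX, hq⟩, hqmin⟩ :=
    ((isCompact_Icc (a := x) (b := p₂)).inter_left hX).exists_isLeast ⟨p₂, hp₂X, hx.2, le_rfl⟩
  have ht₁t : t₁ < t := lt_of_le_of_ne ht₁.2 fun h => htV (h ▸ ht₁V)
  have hpx : p < x := lt_of_le_of_ne hp.2 fun h => hxX (h ▸ hpX)
  have hxq : x < q := lt_of_le_of_ne hq.1 fun h => hxX (h ▸ hqX)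
  have hVn : ∀ s ∈ Ioc t₁ t, s ∉ V := fun s hs hsV =>
    (ht₁max ⟨hsV, ht₁.1.trans hs.1.le, hs.2⟩).not_gt hs.1
  have hXn : ∀ y ∈ Ioo p q, y ∉ X := by
    intro y hy hyX
    rcases le_total y x with h | h
    · exact (hpmax ⟨hyX, hp.1.trans hy.1.le, h⟩).not_gt hy.1
    · exact (hqmin ⟨hyX, h, hy.2.le.trans hq.2⟩).not_gt hy.2
  have hpq : Icc p q ⊆ Icc p₁ p₂ := Icc_subset_Icc hp.1 hq.2
  have hyI : Icc y₁ y₂ ⊆ Ioo l₁ l₂ := fun y hy => ⟨hy₁.trans_le hy.1, hy.2.trans_lt hy₂⟩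
  have hpI : Icc p₁ p₂ ⊆ Icc y₁ y₂ := Icc_subset_Icc hp₁.le hp₂.le
  have hpqI : ∀ y ∈ Icc p q, y ∈ Ioo l₁ l₂ := fun y hy => hyI (hpI (hpq hy))
  have hs : ∀ s ∈ Icc t₁ t, s ∈ Icc τ₁ τ₂ := fun s hs => ⟨ht₁.1.trans hs.1, hs.2.trans ht.2⟩
  have hsT : ∀ s ∈ Icc t₁ t, s ∈ Ioc 0 T := fun s hs' =>
    ⟨hτ₁.trans_le (hs s hs').1, (hs s hs').2.trans hτ₂⟩
  have ht₁m : t₁ ∈ Icc t₁ t := ⟨le_rfl, ht₁t.le⟩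
  have hpm : p ∈ Icc p q := ⟨le_rfl, hpx.le.trans hxq.le⟩
  have hqm : q ∈ Icc p q := ⟨hpx.le.trans hxq.le, le_rfl⟩
  refine abs_le_of_isCaloricOn_strip (y₁ := y₁) (y₂ := y₂) (t₁ := t₁) (p := p) (q := q) hk ht₁t
    (fun s hs' => ?_) (fun y hy s hs' => (hu.pos y (hyI hy) s (hsT s hs')).le)
    (hp₁.trans_le hp.1) (hpx.trans hxq) (hq.2.trans_lt hp₂) ?_
    (fun y hy => hu.hasDerivAt y (hpqI y hy) t₁ (hsT t₁ ht₁m))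
    (fun y hy => hu.hasDerivAt_ux y (hpqI y hy) t₁ (hsT t₁ ht₁m))
    ((hu.continuousOn_space t₁ (hsT t₁ ht₁m)).mono hpqI)
    (fun y hy s hs' => (hu.hasDerivWithinAt y (hpqI y hy) s (hsT s hs')).mono
      fun r hr => Ioc_subset_Icc_self (hsT r hr))
    (fun s hs' => hXN p hpX (hpq hpm) s (hs s hs'))
    (fun s hs' => hXN q hqX (hpq hqm) s (hs s hs'))
    (fun y hy => hVN t₁ ht₁V (hs t₁ ht₁m) y (hpq hy)) x ⟨hpx.le, hxq.le⟩
  · have hsub : ∀ r ∈ Icc s t, r ∈ Icc t₁ t := fun r hr => ⟨hs'.1.le.trans hr.1, hr.2⟩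
    refine hu.isCaloricOn hy₁.le hy₂.le ((hsT s (Ioo_subset_Icc_self hs')).1.le)
      (ht.2.trans hτ₂) ?_
    rintro ⟨y, r⟩ ⟨hy, hr⟩
    refine (hG y hy r (hs r (hsub r hr)) (.inr (hVn r ⟨hs'.1.trans_le hr.1, hr.2⟩))).mono ?_
    exact prod_mono hyI fun r hr => hsT r (hsub r hr)
  · rintro ⟨y, r⟩ ⟨hy, hr⟩
    refine (hG y (hpI (hpq (Ioo_subset_Icc_self hy))) r (hs r hr) (.inl (hXn y hy))).mono ?_
    exact prod_mono (fun y hy => hpqI y (Ioo_subset_Icc_self hy)) hsT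

theorem continuousOn (hu : IsSeparatelyCaloric k u ux uxx l₁ l₂ T) (hk : 0 < k) :
    ContinuousOn (uncurry u) (Ioo l₁ l₂ ×ˢ Ioc 0 T) := by
  set R := Ioo l₁ l₂ ×ˢ Ioc 0 T with hR
  set O := {z | ∀ᶠ z' in 𝓝[R] z, ContinuousWithinAt (uncurry u) R z'} with hO
  have hOo : IsOpen O := by
    simp only [hO, eventually_nhdsWithin_iff]
    exact isOpen_setOfPred_eventually_nhds
  suffices hRO : R ⊆ O from fun z hz => (hRO hz : ∀ᶠ z' in 𝓝[R] z, _).self_of_nhdsWithin hz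
  by_contra hne
  rw [← Set.sdiff_nonempty] at hne
  have hlc : IsLocallyClosed (R \ O) := by
    have h1 : IsLocallyClosed R := by
      have : R = (Ioo l₁ l₂ ×ˢ Ioi 0) ∩ (univ ×ˢ Iic T) := by
        rw [prod_inter_prod, inter_univ, Ioi_inter_Iic]
      rw [this]
      exact (isOpen_Ioo.prod isOpen_Ioi).isLocallyClosed.inter
        (isClosed_univ.prod isClosed_Iic).isLocallyClosed
    exact h1.inter hOo.isClosed_compl.isLocallyClosed
  obtain ⟨⟨x₀, t₀⟩, ⟨hz₀, hz₀O⟩, r, hr, N, hN⟩ := exists_forall_le_of_separately_continuousOn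
    (g := fun x t => |k * uxx x t|)
    (fun t ht => ((hu.continuousOn_space t ht).const_mul k).abs)
    (fun x hx => ((hu.continuousOn_time x hx).const_mul k).abs) sdiff_subset hlc hne
  obtain ⟨hx₀, ht₀⟩ : x₀ ∈ Ioo l₁ l₂ ∧ t₀ ∈ Ioc 0 T := hz₀
  simp only at hN
  obtain ⟨δ, hδ, hδr, hδ₁, hδ₂⟩ : ∃ δ > 0, δ < r ∧ δ < x₀ - l₁ ∧ δ < l₂ - x₀ := by
    obtain ⟨δ, h1, h2⟩ := exists_between
      (lt_min hr (lt_min (sub_pos.2 hx₀.1) (sub_pos.2 hx₀.2)))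
    exact ⟨δ, h1, h2.trans_le (min_le_left _ _),
      h2.trans_le ((min_le_right _ _).trans (min_le_left _ _)),
      h2.trans_le ((min_le_right _ _).trans (min_le_right _ _))⟩
  obtain ⟨ρ, hρ, hρr, hρt⟩ : ∃ ρ > 0, ρ < r ∧ ρ < t₀ := by
    obtain ⟨ρ, h1, h2⟩ := exists_between (lt_min hr ht₀.1)
    exact ⟨ρ, h1, h2.trans_le (min_le_left _ _), h2.trans_le (min_le_right _ _)⟩
  set τ₁ := t₀ - ρ with hτ₁
  set τ₂ := min (t₀ + ρ) T with hτ₂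
  have hτ₁0 : 0 < τ₁ := by linarith
  have hτ₂T : τ₂ ≤ T := min_le_right _ _
  have hxI : Icc (x₀ - δ) (x₀ + δ) ⊆ Ioo l₁ l₂ := fun x hx =>
    ⟨by linarith [hx.1], by linarith [hx.2]⟩
  have htI : Icc τ₁ τ₂ ⊆ Ioc 0 T := fun t ht => ⟨hτ₁0.trans_le ht.1, ht.2.trans hτ₂T⟩
  have hxr : ∀ x ∈ Icc (x₀ - δ) (x₀ + δ), |x - x₀| < r := fun x hx =>
    abs_lt.2 ⟨by linarith [hx.1], by linarith [hx.2]⟩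
  have htr : ∀ t ∈ Icc τ₁ τ₂, |t - t₀| < r := fun t ht =>
    abs_lt.2 ⟨by linarith [ht.1], by linarith [ht.2.trans (min_le_left _ _)]⟩
  set p₁ := x₀ - δ / 2 with hp₁
  set p₂ := x₀ + δ / 2 with hp₂
  have hpI : Icc p₁ p₂ ⊆ Icc (x₀ - δ) (x₀ + δ) := Icc_subset_Icc (by linarith) (by linarith)
  have hp₁m : p₁ ∈ Icc p₁ p₂ := ⟨le_rfl, by linarith⟩
  have hp₂m : p₂ ∈ Icc p₁ p₂ := ⟨by linarith, le_rfl⟩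
  have hτ₁m : τ₁ ∈ Icc τ₁ τ₂ := ⟨le_rfl, le_min (by linarith) (by linarith [ht₀.2])⟩
  obtain ⟨N₁, hN₁⟩ := (isCompact_Icc (a := τ₁) (b := τ₂)).exists_bound_of_continuousOn
    (((hu.continuousOn_time p₁ (hxI (hpI hp₁m))).const_mul k).mono htI)
  obtain ⟨N₂, hN₂⟩ := (isCompact_Icc (a := τ₁) (b := τ₂)).exists_bound_of_continuousOn
    (((hu.continuousOn_time p₂ (hxI (hpI hp₂m))).const_mul k).mono htI)
  obtain ⟨N₃, hN₃⟩ := (isCompact_Icc (a := p₁) (b := p₂)).exists_bound_of_continuousOn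
    (((hu.continuousOn_space τ₁ (htI hτ₁m)).const_mul k).mono (hpI.trans hxI))
  set M := max (max N N₁) (max N₂ N₃) with hM
  have hNM : N ≤ M := (le_max_left _ _).trans (le_max_left _ _)
  have hNM₁ : N₁ ≤ M := (le_max_right _ _).trans (le_max_left _ _)
  have hNM₂ : N₂ ≤ M := (le_max_left _ _).trans (le_max_right _ _)
  have hNM₃ : N₃ ≤ M := (le_max_right _ _).trans (le_max_right _ _)
  set B := (Icc (x₀ - δ) (x₀ + δ) ×ˢ Icc τ₁ τ₂) \ O with hB
  have hBc : IsCompact B := (isCompact_Icc.prod isCompact_Icc).diff hOo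
  have hBS : B ⊆ R \ O := sdiff_subset_sdiff_left (prod_mono hxI htI)
  have hbound : ∀ x ∈ Icc p₁ p₂, ∀ t ∈ Icc τ₁ τ₂, |k * uxx x t| ≤ M := by
    refine hu.abs_le_of_isClosed hk (y₁ := x₀ - δ) (y₂ := x₀ + δ)
      (X := {p₁, p₂} ∪ Prod.fst '' B) (V := {τ₁} ∪ Prod.snd '' B)
      (by linarith) (by linarith) (by linarith) (by linarith) hτ₁0 hτ₂T
      ((toFinite _).isClosed.union (hBc.image continuous_fst).isClosed)
      (isClosed_singleton.union (hBc.image continuous_snd).isClosed)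
      (by simp) (by simp) (by simp) ?_ ?_ ?_
    · rintro x ((rfl | rfl) | ⟨⟨x, t⟩, hz, rfl⟩) hx s hs
      · exact (hN₁ s hs).trans hNM₁
      · exact (hN₂ s hs).trans hNM₂
      · exact ((hN _ (hBS hz) (hxr x hz.1.1) (htr t hz.1.2)).2 s (htI hs) (htr s hs)).trans hNM
    · rintro s (rfl | ⟨⟨x', t⟩, hz, rfl⟩) hs x hx
      · exact (hN₃ x hx).trans hNM₃
      · exact ((hN _ (hBS hz) (hxr x' hz.1.1) (htr t hz.1.2)).1 x (hxI (hpI hx))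
          (hxr x (hpI hx))).trans hNM
    · intro x hx s hs hxs
      have hzO : (x, s) ∈ O := by
        by_contra h
        have hz : (x, s) ∈ B := ⟨⟨hx, hs⟩, h⟩
        rcases hxs with h | h
        · exact h (.inr ⟨_, hz, rfl⟩)
        · exact h (.inr ⟨_, hz, rfl⟩)
      exact (hzO : ∀ᶠ z' in 𝓝[R] (x, s), _).self_of_nhdsWithin ⟨hxI hx, htI hs⟩
  have hM0 : 0 ≤ M := (abs_nonneg _).trans (hbound p₁ hp₁m τ₁ hτ₁m)
  have hcont : ContinuousOn (uncurry u) (Icc p₁ p₂ ×ˢ Icc τ₁ τ₂) := by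
    refine continuousOn_prod_of_continuousOn_lipschitzOnWith' _ (⟨M, hM0⟩ : NNReal)
      (fun x hx => ?_) fun t ht x hx => ?_
    · exact (convex_Icc τ₁ τ₂).lipschitzOnWith_of_nnnorm_hasDerivWithin_le
        (fun s hs => (hu.hasDerivWithinAt x (hxI (hpI hx)) s (htI hs)).mono
          (htI.trans Ioc_subset_Icc_self)) fun s hs => hbound x hx s hs
    · exact (hu.hasDerivAt x (hxI (hpI hx)) t (htI ht)).continuousAt.continuousWithinAt
  refine hz₀O ?_
  have hW : Ioo p₁ p₂ ×ˢ Ioo τ₁ (t₀ + ρ) ∈ 𝓝 (x₀, t₀) :=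
    prod_mem_nhds (Ioo_mem_nhds (by linarith) (by linarith))
      (Ioo_mem_nhds (by linarith) (by linarith))
  filter_upwards [nhdsWithin_le_nhds (eventually_mem_nhds_iff.2 hW), self_mem_nhdsWithin] with z hz hzR
  have hsub : Ioo p₁ p₂ ×ˢ Ioo τ₁ (t₀ + ρ) ∩ R ⊆ Icc p₁ p₂ ×ˢ Icc τ₁ τ₂ := fun z hz =>
    ⟨Ioo_subset_Icc_self hz.1.1, hz.1.2.1.le, le_min hz.1.2.2.le hz.2.2.2⟩
  refine (hcont z (hsub ⟨mem_of_mem_nhds hz, hzR⟩)).mono_of_mem_nhdsWithin ?_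
  exact mem_of_superset (inter_mem (nhdsWithin_le_nhds hz) self_mem_nhdsWithin) hsub

end IsSeparatelyCaloric

theorem IsSeparatelyCaloric.exists_hasDerivAt_uxx {k l₁ l₂ T : ℝ} {u ux uxx : ℝ → ℝ → ℝ}
    (hu : IsSeparatelyCaloric k u ux uxx l₁ l₂ T) (hk : 0 < k) {x t : ℝ} (hx : x ∈ Ioo l₁ l₂)
    (ht : t ∈ Ioc 0 T) :
    ∃ d, HasDerivAt (fun y => uxx y t) d x ∧ HasDerivWithinAt (ux x) (k * d) (Icc 0 T) t := by
  obtain ⟨y₁, h1, h2⟩ := exists_between hx.1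
  obtain ⟨z₁, h3, h4⟩ := exists_between h2
  obtain ⟨z₂, h5, h6⟩ := exists_between hx.2
  obtain ⟨y₂, h7, h8⟩ := exists_between h6
  obtain ⟨τ, h9, h10⟩ := exists_between ht.1
  obtain ⟨σ, h11, h12⟩ := exists_between h9
  have hcal : IsCaloricOn k u ux uxx y₁ y₂ σ T :=
    hu.isCaloricOn h1.le h8.le h11.le le_rfl ((hu.continuousOn hk).mono
      (prod_mono (fun y hy => ⟨h1.trans_le hy.1, hy.2.trans_lt h8⟩)
        fun s hs => ⟨h11.trans_le hs.1, hs.2⟩))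
  obtain ⟨fxxx, hf⟩ := hcal.exists_isCaloricOn_fx hk h3 h7 h12
  refine ⟨fxxx x t, hf.hasDerivAt_fx x ⟨h4, h5⟩ t ⟨h10, ht.2⟩, ?_⟩
  refine (hf.hasDerivWithinAt x ⟨h4, h5⟩ t ⟨h10, ht.2⟩).mono_of_mem_nhdsWithin ?_
  filter_upwards [nhdsWithin_le_nhds (Ioi_mem_nhds h10), self_mem_nhdsWithin] with s hs hs'
  exact ⟨(show τ < s from hs).le, hs'.2⟩

/-- The primitive of a continuous function has the expected one-sided derivatives. -/
theorem hasDerivWithinAt_integral_Icc {f : ℝ → ℝ} {a b x : ℝ} (hf : ContinuousOn f (Icc a b))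
    (hx : x ∈ Icc a b) : HasDerivWithinAt (fun z => ∫ y in a..z, f y) (f x) (Icc a b) x := by
  have : Fact (x ∈ Icc a b) := ⟨hx⟩
  refine intervalIntegral.integral_hasDerivWithinAt_right (t := Icc a b) ?_
    (hf.stronglyMeasurableAtFilter_nhdsWithin measurableSet_Icc x) (hf x hx)
  exact (hf.mono (Icc_subset_Icc_right hx.2)).intervalIntegrable_of_Icc hx.1

end

/-- Hopf-Cole for the full initial-boundary value problem: a positive solution `u` of the
heat equation with Robin boundary conditions and initial datum
`u(l₁,0)·exp(-(1/(2a²))∫_{l₁}^x w₀)` yields, via `w = -2a² uₓ/u`, a solution of Burgers'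
equation with initial datum `w₀` and Dirichlet boundary values `α₁, α₂`. -/
theorem stmt_3 (a l₁ l₂ T α₁ α₂ : ℝ) (ha : 0 < a) (hl : l₁ < l₂) (hT : 0 < T)
    (w₀ : ℝ → ℝ) (hw₀ : ContinuousOn w₀ (Icc l₁ l₂))
    (u w : ℝ → ℝ → ℝ)
    (hw : ∀ x t, w x t =
      -2 * a ^ 2 * derivWithin (fun x' => u x' t) (Icc l₁ l₂) x / u x t)
    (hpos : ∀ x ∈ Icc l₁ l₂, ∀ t ∈ Icc 0 T, 0 < u x t)
    -- continuously differentiable in `x` up to the boundary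
    (hdx : ∀ t ∈ Ioc 0 T, ∀ x ∈ Icc l₁ l₂,
      DifferentiableWithinAt ℝ (fun x' => u x' t) (Icc l₁ l₂) x)
    (hdxC : ∀ t ∈ Ioc 0 T,
      ContinuousOn (fun x => derivWithin (fun x' => u x' t) (Icc l₁ l₂) x) (Icc l₁ l₂))
    -- twice continuously differentiable in `x` in the interior
    (hdxx : ∀ t ∈ Ioc 0 T, ∀ x ∈ Ioo l₁ l₂,
      DifferentiableWithinAt ℝ
        (fun x' => derivWithin (fun y => u y t) (Icc l₁ l₂) x') (Icc l₁ l₂) x)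
    (hdxxC : ∀ t ∈ Ioc 0 T,
      ContinuousOn
        (fun x => derivWithin (fun x' => derivWithin (fun y => u y t) (Icc l₁ l₂) x')
          (Icc l₁ l₂) x) (Ioo l₁ l₂))
    -- once continuously differentiable in `t`
    (hdt : ∀ x ∈ Ioo l₁ l₂, ∀ t ∈ Ioc 0 T,
      DifferentiableWithinAt ℝ (fun t' => u x t') (Icc 0 T) t)
    (hdtC : ∀ x ∈ Ioo l₁ l₂,
      ContinuousOn (fun t => derivWithin (fun t' => u x t') (Icc 0 T) t) (Ioc 0 T))
    -- (i) heat equation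
    (hheat : ∀ x ∈ Ioo l₁ l₂, ∀ t ∈ Ioc 0 T,
      derivWithin (fun t' => u x t') (Icc 0 T) t =
        a ^ 2 * derivWithin (fun x' => derivWithin (fun y => u y t) (Icc l₁ l₂) x')
          (Icc l₁ l₂) x)
    -- (ii) initial condition
    (hinit : ∀ x ∈ Icc l₁ l₂,
      u x 0 = u l₁ 0 * Real.exp (-(1 / (2 * a ^ 2)) * ∫ y in l₁..x, w₀ y))
    -- (iii) Robin boundary conditions
    (hrobin₁ : ∀ t ∈ Icc 0 T,
      α₁ * u l₁ t + 2 * a ^ 2 * derivWithin (fun x => u x t) (Icc l₁ l₂) l₁ = 0)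
    (hrobin₂ : ∀ t ∈ Icc 0 T,
      α₂ * u l₂ t + 2 * a ^ 2 * derivWithin (fun x => u x t) (Icc l₁ l₂) l₂ = 0) :
    (∀ x ∈ Ioo l₁ l₂, ∀ t ∈ Ioc 0 T,
      derivWithin (fun t' => w x t') (Icc 0 T) t
        - a ^ 2 * derivWithin (fun x' => derivWithin (fun y => w y t) (Icc l₁ l₂) x')
            (Icc l₁ l₂) x
        + w x t * derivWithin (fun x' => w x' t) (Icc l₁ l₂) x = 0) ∧
    (∀ x ∈ Icc l₁ l₂, w x 0 = w₀ x) ∧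
    (∀ t ∈ Icc 0 T, w l₁ t = α₁ ∧ w l₂ t = α₂) := by
  set ux : ℝ → ℝ → ℝ := fun x t => derivWithin (fun x' => u x' t) (Icc l₁ l₂) x with hux
  set uxx : ℝ → ℝ → ℝ := fun x t => derivWithin (fun y => ux y t) (Icc l₁ l₂) x with huxx
  have hw' : ∀ x t, w x t = -2 * a ^ 2 * ux x t / u x t := hw
  have ha2 : 0 < a ^ 2 := pow_pos ha 2
  have hu : IsSeparatelyCaloric (a ^ 2) u ux uxx l₁ l₂ T :=
    { pos := fun x hx t ht => hpos x (Ioo_subset_Icc_self hx) t (Ioc_subset_Icc_self ht)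
      hasDerivAt := fun x hx t ht => (hdx t ht x (Ioo_subset_Icc_self hx)).hasDerivWithinAt.hasDerivAt
        (Icc_mem_nhds hx.1 hx.2)
      hasDerivAt_ux := fun x hx t ht => (hdxx t ht x hx).hasDerivWithinAt.hasDerivAt
        (Icc_mem_nhds hx.1 hx.2)
      hasDerivWithinAt := fun x hx t ht => by
        have := (hdt x hx t ht).hasDerivWithinAt
        rwa [hheat x hx t ht] at this
      continuousOn_space := hdxxC
      continuousOn_time := fun x hx => by
        refine (((hdtC x hx).congr fun t ht => (hheat x hx t ht).symm).const_mul
          (a ^ 2)⁻¹).congr fun t ht => ?_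
        exact (inv_mul_cancel_left₀ ha2.ne' _).symm }
  refine ⟨fun x hx t ht => ?_, fun x hx => ?_, fun t ht => ⟨?_, ?_⟩⟩
  · obtain ⟨d, hd, hd'⟩ := hu.exists_hasDerivAt_uxx ha2 hx ht
    have hwx : ∀ y ∈ Ioo l₁ l₂, HasDerivAt (fun z => w z t)
        (-2 * a ^ 2 * (uxx y t * u y t - ux y t * ux y t) / u y t ^ 2) y := fun y hy => by
      simp only [hw']
      exact (((hu.hasDerivAt_ux y hy t ht).const_mul (-2 * a ^ 2)).div (hu.hasDerivAt y hy t ht)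
        (hu.pos y hy t ht).ne').congr_deriv (by ring)
    have hdw : ∀ y ∈ Ioo l₁ l₂, derivWithin (fun z => w z t) (Icc l₁ l₂) y =
        -2 * a ^ 2 * (uxx y t * u y t - ux y t * ux y t) / u y t ^ 2 := fun y hy => by
      rw [derivWithin_of_mem_nhds (Icc_mem_nhds hy.1 hy.2), (hwx y hy).deriv]
    have h0 := hu.hasDerivAt x hx t ht
    have h1 := hu.hasDerivAt_ux x hx t ht
    have hne := (hu.pos x hx t ht).ne'
    have hwxx := (((((hd.mul h0).sub (h1.mul h1)).const_mul (-2 * a ^ 2)).div (h0.pow 2)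
      (pow_ne_zero 2 hne)).congr_of_eventuallyEq
        (f₁ := fun y => derivWithin (fun z => w z t) (Icc l₁ l₂) y)
        (by filter_upwards [Ioo_mem_nhds hx.1 hx.2] with y hy using hdw y hy))
    have hwt : HasDerivWithinAt (fun s => w x s)
        (-2 * a ^ 2 * (a ^ 2 * d * u x t - ux x t * (a ^ 2 * uxx x t)) / u x t ^ 2)
        (Icc 0 T) t := by
      simp only [hw']
      exact ((hd'.const_mul (-2 * a ^ 2)).div (hu.hasDerivWithinAt x hx t ht) hne).congr_deriv
        (by ring)
    rw [hwt.derivWithin (uniqueDiffOn_Icc hT t (Ioc_subset_Icc_self ht)), hdw x hx,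
      derivWithin_of_mem_nhds (Icc_mem_nhds hx.1 hx.2), hwxx.deriv, hw']
    simp only [Pi.mul_apply, Pi.sub_apply, Pi.pow_apply]
    field_simp
    ring
  · have h0 := hpos l₁ ⟨le_rfl, hl.le⟩ 0 ⟨le_rfl, hT.le⟩
    have h1 : HasDerivWithinAt (fun y => u y 0) (u x 0 * (-(1 / (2 * a ^ 2)) * w₀ x))
        (Icc l₁ l₂) x := by
      refine HasDerivWithinAt.congr ?_ hinit (hinit x hx)
      refine (((hasDerivWithinAt_integral_Icc hw₀ hx).const_mul
        (-(1 / (2 * a ^ 2)))).exp.const_mul (u l₁ 0)).congr_deriv ?_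
      rw [hinit x hx]
      ring
    have hne := (hpos x hx 0 ⟨le_rfl, hT.le⟩).ne'
    rw [hw, h1.derivWithin (uniqueDiffOn_Icc hl x hx)]
    field_simp
  · have hne := (hpos l₁ ⟨le_rfl, hl.le⟩ t ht).ne'
    rw [hw, div_eq_iff hne]
    linarith [hrobin₁ t ht]
  · have hne := (hpos l₂ ⟨hl.le, le_rfl⟩ t ht).ne'
    rw [hw, div_eq_iff hne]
    linarith [hrobin₂ t ht]
end

section
/- Let a > 0, p > 0, and ξ ∈ ℝ. Then ∫₀^∞ e^{-pt} · (1/(2a√(πt))) · exp( -ξ²/(4a²t) ) dt = (1/(2a√p)) · exp( -|ξ|√p / a ). -/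
open Real Set MeasureTheory

theorem image_div_Ioi {k : ℝ} (hk : 0 < k) : (fun x : ℝ => k / x) '' Ioi 0 = Ioi 0 := by
  ext y
  simp only [mem_image, mem_Ioi]
  constructor
  · rintro ⟨x, hx, rfl⟩
    positivity
  · intro hy
    exact ⟨k / y, by positivity, by field_simp⟩

theorem injOn_mul_sub_div {b c : ℝ} (hb : 0 < b) (hc : 0 < c) :
    InjOn (fun x : ℝ => c * x - b / x) (Ioi 0) := by
  refine StrictMonoOn.injOn fun x hx y hy hxy => ?_
  simp only [mem_Ioi] at hx hy
  have h₁ : b / y < b / x := by gcongr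
  have h₂ : c * x < c * y := by gcongr
  linarith

theorem image_mul_sub_div {b c : ℝ} (hb : 0 < b) (hc : 0 < c) :
    (fun x : ℝ => c * x - b / x) '' Ioi 0 = univ := by
  refine eq_univ_of_forall fun u => ?_
  have hbc : 0 < 4 * b * c := by positivity
  have hs : √(u ^ 2 + 4 * b * c) ^ 2 = u ^ 2 + 4 * b * c := Real.sq_sqrt (by positivity)
  have hpos : 0 < u + √(u ^ 2 + 4 * b * c) := by
    have h : |u| < √(u ^ 2 + 4 * b * c) := by
      rw [← Real.sqrt_sq_eq_abs]
      exact Real.sqrt_lt_sqrt (sq_nonneg u) (by linarith)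
    linarith [neg_abs_le u]
  refine ⟨(u + √(u ^ 2 + 4 * b * c)) / (2 * c), div_pos hpos (by positivity), ?_⟩
  generalize √(u ^ 2 + 4 * b * c) = s at hs hpos
  have hne : u + s ≠ 0 := hpos.ne'
  dsimp only
  field_simp
  linear_combination hs

theorem hasDerivAt_const_div {k x : ℝ} (hx : x ≠ 0) :
    HasDerivAt (fun x : ℝ => k / x) (-(k / x ^ 2)) x := by
  have h := (hasDerivAt_inv hx).const_mul k
  simp only [← div_eq_mul_inv] at h
  exact h.congr_deriv (by ring)

theorem hasDerivAt_mul_sub_div {b c x : ℝ} (hx : x ≠ 0) :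
    HasDerivAt (fun x : ℝ => c * x - b / x) (c + b / x ^ 2) x :=
  (((hasDerivAt_id x).const_mul c).sub (hasDerivAt_const_div hx)).congr_deriv (by ring)

/-- The Cauchy–Schlömilch substitution applied to the Gaussian integral. -/
theorem integral_exp_neg_mul_sub_div_sq {b c : ℝ} (hb : 0 < b) (hc : 0 < c) :
    ∫ x in Ioi (0 : ℝ), exp (-(c * x - b / x) ^ 2) = √π / (2 * c) := by
  have hderiv : ∀ x ∈ Ioi (0 : ℝ),
      HasDerivWithinAt (fun x : ℝ => c * x - b / x) (c + b / x ^ 2) (Ioi 0) x :=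
    fun x hx => (hasDerivAt_mul_sub_div (ne_of_gt hx)).hasDerivWithinAt
  have hgauss : Integrable fun u : ℝ => exp (-u ^ 2) := by
    simpa using integrable_exp_neg_mul_sq (zero_lt_one' ℝ)
  have hval : ∫ u : ℝ, exp (-u ^ 2) = √π := by
    simpa using integral_gaussian 1
  have habs : ∀ x : ℝ, |c + b / x ^ 2| = c + b / x ^ 2 := fun x => abs_of_pos (by positivity)
  have hsum := integral_image_eq_integral_abs_deriv_smul measurableSet_Ioi hderiv
    (injOn_mul_sub_div hb hc) fun u => exp (-u ^ 2)
  have hint := (integrableOn_image_iff_integrableOn_abs_deriv_smul measurableSet_Ioi hderiv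
    (injOn_mul_sub_div hb hc) fun u => exp (-u ^ 2)).1 (by
      rw [image_mul_sub_div hb hc]
      exact hgauss.integrableOn)
  simp only [image_mul_sub_div hb hc, Measure.restrict_univ, hval, habs, smul_eq_mul] at hsum hint
  have hmeas : Measurable fun x : ℝ => exp (-(c * x - b / x) ^ 2) := by fun_prop
  have hint₁ : IntegrableOn (fun x : ℝ => c * exp (-(c * x - b / x) ^ 2)) (Ioi 0) := by
    refine Integrable.mono' hint (hmeas.const_mul c).aestronglyMeasurable (.of_forall fun x => ?_)
    rw [Real.norm_of_nonneg (by positivity)]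
    gcongr
    exact le_add_of_nonneg_right (by positivity)
  have hint₂ : IntegrableOn (fun x : ℝ => b / x ^ 2 * exp (-(c * x - b / x) ^ 2)) (Ioi 0) := by
    refine (hint.sub hint₁).congr (.of_forall fun x => ?_)
    simp only [Pi.sub_apply]
    ring
  have hk : 0 < b / c := by positivity
  have hsymm := integral_image_eq_integral_abs_deriv_smul measurableSet_Ioi
    (fun x (hx : x ∈ Ioi (0 : ℝ)) =>
      (hasDerivAt_const_div (k := b / c) (ne_of_gt hx)).hasDerivWithinAt)
    (fun x hx y hy hxy => by
      simp only [mem_Ioi] at hx hy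
      field_simp at hxy
      exact hxy.symm) fun x => c * exp (-(c * x - b / x) ^ 2)
  rw [image_div_Ioi hk] at hsymm
  have hswap : ∫ x in Ioi (0 : ℝ), c * exp (-(c * x - b / x) ^ 2) =
      ∫ x in Ioi (0 : ℝ), b / x ^ 2 * exp (-(c * x - b / x) ^ 2) := by
    rw [hsymm]
    refine setIntegral_congr_fun measurableSet_Ioi fun x (hx : 0 < x) => ?_
    have harg : c * (b / c / x) - b / (b / c / x) = -(c * x - b / x) := by
      field_simp
      ring
    have hcoef : |(-(b / c / x ^ 2))| = b / c / x ^ 2 := by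
      rw [abs_neg, abs_of_pos (by positivity)]
    simp only [smul_eq_mul, harg, hcoef, neg_sq]
    field_simp
  simp only [add_mul] at hsum
  rw [integral_add hint₁ hint₂, ← hswap, integral_const_mul] at hsum
  rw [eq_div_iff (by positivity)]
  linarith

theorem integral_exp_neg_sq_mul_sub_sq_div {b c : ℝ} (hb : 0 ≤ b) (hc : 0 < c) :
    ∫ x in Ioi (0 : ℝ), exp (-(c * x) ^ 2 - (b / x) ^ 2) =
      √π / (2 * c) * exp (-(2 * b * c)) := by
  rcases hb.eq_or_lt with rfl | hb
  · have h := integral_gaussian_Ioi (c ^ 2)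
    rw [Real.sqrt_div pi_pos.le, Real.sqrt_sq hc.le] at h
    simp only [zero_div, mul_zero, zero_mul, neg_zero, exp_zero, mul_one, ne_eq,
      OfNat.ofNat_ne_zero, not_false_eq_true, zero_pow, sub_zero, mul_pow]
    simp only [neg_mul] at h
    rw [h]
    field_simp
  · rw [← integral_exp_neg_mul_sub_div_sq hb hc, ← integral_mul_const]
    refine setIntegral_congr_fun measurableSet_Ioi fun x (hx : 0 < x) => ?_
    simp only [← exp_add]
    congr 1
    field_simp
    ring

theorem integral_Ioi_eq_integral_comp_sq (g : ℝ → ℝ) :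
    ∫ t in Ioi (0 : ℝ), g t = ∫ x in Ioi (0 : ℝ), 2 * x * g (x ^ 2) := by
  rw [← integral_comp_rpow_Ioi_of_pos (g := g) (zero_lt_two' ℝ)]
  refine setIntegral_congr_fun measurableSet_Ioi fun x _ => ?_
  norm_num

/-- The Laplace transform of the heat kernel:
`∫₀^∞ e^{-pt} (1/(2a√(πt))) e^{-ξ²/(4a²t)} dt = (1/(2a√p)) e^{-|ξ|√p/a}`. -/
theorem stmt_4 (a p ξ : ℝ) (ha : 0 < a) (hp : 0 < p) :
    ∫ t in Ioi (0 : ℝ),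
        Real.exp (-p * t) * (1 / (2 * a * Real.sqrt (π * t))) *
          Real.exp (-ξ ^ 2 / (4 * a ^ 2 * t))
      = 1 / (2 * a * Real.sqrt p) * Real.exp (-|ξ| * Real.sqrt p / a) := by
  have hc : 0 < √p := Real.sqrt_pos.2 hp
  have hpi : 0 < √π := Real.sqrt_pos.2 pi_pos
  have key := integral_exp_neg_sq_mul_sub_sq_div (b := |ξ| / (2 * a)) (by positivity) hc
  rw [integral_Ioi_eq_integral_comp_sq]
  trans ∫ x in Ioi (0 : ℝ),
      1 / (a * √π) * exp (-(√p * x) ^ 2 - (|ξ| / (2 * a) / x) ^ 2)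
  · refine setIntegral_congr_fun measurableSet_Ioi fun x (hx : 0 < x) => ?_
    have hexp : -(√p * x) ^ 2 - (|ξ| / (2 * a) / x) ^ 2 =
        -p * x ^ 2 + -ξ ^ 2 / (4 * a ^ 2 * x ^ 2) := by
      rw [mul_pow, Real.sq_sqrt hp.le, div_pow, div_pow, sq_abs]
      field_simp
      ring
    simp only [hexp, exp_add, Real.sqrt_mul pi_pos.le, Real.sqrt_sq hx.le]
    field_simp
  · rw [integral_const_mul, key]
    have hexp : -(2 * (|ξ| / (2 * a)) * √p) = -|ξ| * √p / a := by field_simp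
    rw [hexp]
    field_simp
end

section
/- Let a > 0, p > 0, l₁ < l₂, let φ : [l₁,l₂] → ℝ be continuous, and define R(x,p) = ∫_{l₁}^{l₂} ( φ(ξ) / (2a√p) ) · exp( -|ξ - x|√p / a ) dξ. Then x ↦ R(x,p) is twice continuously differentiable on (l₁,l₂) and satisfies the ordinary differential equation -a² R_xx(x,p) + p R(x,p) = φ(x) for all x ∈ (l₁,l₂). -/
open Real Set

/-- The fundamental theorem of calculus at an interior point, with base point anywhere in the
closed interval on which the integrand is continuous. -/
theorem hasDerivAt_integral_of_continuousOn_Icc {g : ℝ → ℝ} {l₁ l₂ b x : ℝ}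
    (hg : ContinuousOn g (Icc l₁ l₂)) (hb : b ∈ Icc l₁ l₂) (hx : x ∈ Ioo l₁ l₂) :
    HasDerivAt (fun t => ∫ ξ in b..t, g ξ) (g x) x := by
  refine intervalIntegral.integral_hasDerivAt_right ?_ ?_ ?_
  · exact (hg.mono (uIcc_subset_Icc hb (Ioo_subset_Icc_self hx))).intervalIntegrable
  · exact (hg.mono Ioo_subset_Icc_self).stronglyMeasurableAtFilter isOpen_Ioo x hx
  · exact hg.continuousAt (Icc_mem_nhds hx.1 hx.2)

/-- Convolution with a two-sided exponential, split at the kink of the kernel. -/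
theorem integral_mul_exp_neg_abs_sub {φ : ℝ → ℝ} {l₁ l₂ x : ℝ} (k : ℝ)
    (hφ : ContinuousOn φ (Icc l₁ l₂)) (hx : x ∈ Icc l₁ l₂) :
    ∫ ξ in l₁..l₂, φ ξ * Real.exp (-k * |ξ - x|) =
      Real.exp (-k * x) * (∫ ξ in l₁..x, φ ξ * Real.exp (k * ξ)) -
        Real.exp (k * x) * ∫ ξ in l₂..x, φ ξ * Real.exp (-k * ξ) := by
  have hcont : ContinuousOn (fun ξ => φ ξ * Real.exp (-k * |ξ - x|)) (Icc l₁ l₂) :=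
    hφ.mul (by fun_prop)
  have hl : l₁ ≤ l₂ := hx.1.trans hx.2
  have hint : ∀ u ∈ Icc l₁ l₂, ∀ v ∈ Icc l₁ l₂, IntervalIntegrable
      (fun ξ => φ ξ * Real.exp (-k * |ξ - x|)) MeasureTheory.volume u v :=
    fun u hu v hv => (hcont.mono (uIcc_subset_Icc hu hv)).intervalIntegrable
  rw [← intervalIntegral.integral_add_adjacent_intervals
    (hint l₁ (left_mem_Icc.2 hl) x hx) (hint x hx l₂ (right_mem_Icc.2 hl)),
    intervalIntegral.integral_symm x l₂, mul_neg, sub_neg_eq_add,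
    ← intervalIntegral.integral_const_mul, ← intervalIntegral.integral_const_mul]
  congr 1
  · refine intervalIntegral.integral_congr fun ξ hξ => ?_
    rw [uIcc_of_le hx.1] at hξ
    have h : -k * |ξ - x| = -k * x + k * ξ := by
      rw [abs_of_nonpos (sub_nonpos.2 hξ.2)]; ring
    simp only [h, Real.exp_add]
    ring
  · refine intervalIntegral.integral_congr fun ξ hξ => ?_
    rw [uIcc_of_le hx.2] at hξ
    have h : -k * |ξ - x| = k * x + -k * ξ := by
      rw [abs_of_nonneg (sub_nonneg.2 hξ.1)]; ring
    simp only [h, Real.exp_add]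
    ring

/-- `R(x,p) = ∫_{l₁}^{l₂} (φ(ξ)/(2a√p)) e^{-|ξ-x|√p/a} dξ` is twice continuously
differentiable in `x` on `(l₁,l₂)` and satisfies `-a² R'' + p R = φ` there. -/
theorem stmt_8 (a p l₁ l₂ : ℝ) (ha : 0 < a) (hp : 0 < p) (hl : l₁ < l₂)
    (φ : ℝ → ℝ) (hφ : ContinuousOn φ (Icc l₁ l₂))
    (R : ℝ → ℝ)
    (hR : ∀ x : ℝ, R x = ∫ ξ in l₁..l₂,
      φ ξ / (2 * a * Real.sqrt p) * Real.exp (-|ξ - x| * Real.sqrt p / a)) :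
    ContDiffOn ℝ 2 R (Ioo l₁ l₂) ∧
    ∀ x ∈ Ioo l₁ l₂, -a ^ 2 * deriv (deriv R) x + p * R x = φ x := by
  have hs : 0 < Real.sqrt p := Real.sqrt_pos.2 hp
  have hsq : Real.sqrt p ^ 2 = p := Real.sq_sqrt hp.le
  set s := Real.sqrt p
  set k := s / a with hk
  set c := 1 / (2 * a * s) with hc
  set A : ℝ → ℝ := fun x => ∫ ξ in l₁..x, φ ξ * Real.exp (k * ξ)
  set B : ℝ → ℝ := fun x => ∫ ξ in l₂..x, φ ξ * Real.exp (-k * ξ)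
  have hRAB : ∀ x ∈ Ioo l₁ l₂,
      R x = c * (Real.exp (-k * x) * A x - Real.exp (k * x) * B x) := by
    intro x hx
    rw [hR, ← integral_mul_exp_neg_abs_sub k hφ (Ioo_subset_Icc_self hx),
      ← intervalIntegral.integral_const_mul]
    congr 1
    ext ξ
    rw [show -|ξ - x| * s / a = -k * |ξ - x| by rw [hk]; ring, hc]
    ring
  have hA : ∀ x ∈ Ioo l₁ l₂, HasDerivAt A (φ x * Real.exp (k * x)) x := fun x hx =>
    hasDerivAt_integral_of_continuousOn_Icc (g := fun ξ => φ ξ * Real.exp (k * ξ))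
      (hφ.mul (by fun_prop)) (left_mem_Icc.2 hl.le) hx
  have hB : ∀ x ∈ Ioo l₁ l₂, HasDerivAt B (φ x * Real.exp (-k * x)) x := fun x hx =>
    hasDerivAt_integral_of_continuousOn_Icc (g := fun ξ => φ ξ * Real.exp (-k * ξ))
      (hφ.mul (by fun_prop)) (right_mem_Icc.2 hl.le) hx
  have hE : ∀ r x : ℝ, HasDerivAt (fun t => Real.exp (r * t)) (Real.exp (r * x) * r) x :=
    fun r x => by simpa using ((hasDerivAt_id x).const_mul r).exp
  have hEE : ∀ x : ℝ, Real.exp (-k * x) * Real.exp (k * x) = 1 := fun x => by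
    rw [← Real.exp_add]; simp
  have hR₁ : ∀ x ∈ Ioo l₁ l₂, HasDerivAt R
      (-(c * k) * (Real.exp (-k * x) * A x + Real.exp (k * x) * B x)) x := by
    intro x hx
    have h := (((hE (-k) x).mul (hA x hx)).sub ((hE k x).mul (hB x hx))).const_mul c
    refine (h.congr_of_eventuallyEq ?_).congr_deriv ?_
    · filter_upwards [isOpen_Ioo.mem_nhds hx] with y hy
      exact hRAB y hy
    · ring
  have hR₂ : ∀ x ∈ Ioo l₁ l₂, HasDerivAt (deriv R) (k ^ 2 * R x - 2 * c * k * φ x) x := by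
    intro x hx
    have h := (((hE (-k) x).mul (hA x hx)).add ((hE k x).mul (hB x hx))).const_mul (-(c * k))
    refine (h.congr_of_eventuallyEq ?_).congr_deriv ?_
    · filter_upwards [isOpen_Ioo.mem_nhds hx] with y hy
      exact (hR₁ y hy).deriv
    · rw [hRAB x hx]
      linear_combination (-2 * c * k * φ x) * hEE x
  refine ⟨?_, fun x hx => ?_⟩
  · rw [show (2 : WithTop ℕ∞) = 1 + 1 by norm_num,
      contDiffOn_succ_iff_deriv_of_isOpen isOpen_Ioo]
    refine ⟨fun x hx => (hR₁ x hx).differentiableAt.differentiableWithinAt, by simp, ?_⟩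
    rw [show (1 : WithTop ℕ∞) = 0 + 1 by norm_num,
      contDiffOn_succ_iff_deriv_of_isOpen isOpen_Ioo]
    refine ⟨fun x hx => (hR₂ x hx).differentiableAt.differentiableWithinAt, by simp, ?_⟩
    rw [contDiffOn_zero]
    have hRc : ContinuousOn R (Ioo l₁ l₂) := fun x hx =>
      (hR₁ x hx).continuousAt.continuousWithinAt
    exact ((hRc.const_mul (k ^ 2)).sub
      ((hφ.mono Ioo_subset_Icc_self).const_mul (2 * c * k))).congr
      fun x hx => (hR₂ x hx).deriv
  · have h₁ : a ^ 2 * k ^ 2 = p := by rw [hk, ← hsq]; field_simp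
    have h₂ : a ^ 2 * (2 * c * k) = 1 := by rw [hk, hc]; field_simp
    rw [(hR₂ x hx).deriv]
    linear_combination (-R x) * h₁ + φ x * h₂
end

section
/- Let a > 0, b ∈ ℝ, l₁ < l₂, T > 0, and let (α₁,β₁) ≠ (0,0), (α₂,β₂) ≠ (0,0) be pairs of real numbers. Suppose u₁ and u₂ are both continuous on [l₁,l₂] × [0,T], twice continuously differentiable in x and once in t on [l₁,l₂] × (0,T], and both satisfy: u_t - a² u_xx + b u = f(x,t) on (l₁,l₂) × (0,T], the same initial condition u(x,0) = φ(x) on [l₁,l₂], and the same boundary conditions α₁ u(l₁,t) + β₁ u_x(l₁,t) = g₁(t) and α₂ u(l₂,t) + β₂ u_x(l₂,t) = g₂(t) for t ∈ (0,T]. Then u₁ = u₂ on [l₁,l₂] × [0,T]. -/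
open Real Set

/-- `u` is a (classical, continuous up to the boundary) solution of the linear
reaction-diffusion initial-boundary value problem
`u_t - a² u_xx + b u = f` on `(l₁,l₂) × (0,T]`, `u(·,0) = φ`,
`αᵢ u + βᵢ u_x = gᵢ` at the endpoints. -/
def IsRDSolution (a b l₁ l₂ T : ℝ) (f : ℝ → ℝ → ℝ) (φ : ℝ → ℝ)
    (α₁ β₁ α₂ β₂ : ℝ) (g₁ g₂ : ℝ → ℝ) (u : ℝ → ℝ → ℝ) : Prop :=
  ContinuousOn (fun q : ℝ × ℝ => u q.1 q.2) (Icc l₁ l₂ ×ˢ Icc 0 T) ∧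
  (∀ t ∈ Ioc 0 T, ∀ x ∈ Icc l₁ l₂,
    DifferentiableWithinAt ℝ (fun x' => u x' t) (Icc l₁ l₂) x) ∧
  (∀ t ∈ Ioc 0 T, ∀ x ∈ Icc l₁ l₂,
    DifferentiableWithinAt ℝ
      (fun x' => derivWithin (fun y => u y t) (Icc l₁ l₂) x') (Icc l₁ l₂) x) ∧
  (∀ t ∈ Ioc 0 T,
    ContinuousOn
      (fun x => derivWithin (fun x' => derivWithin (fun y => u y t) (Icc l₁ l₂) x')
        (Icc l₁ l₂) x) (Icc l₁ l₂)) ∧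
  (∀ x ∈ Icc l₁ l₂, ∀ t ∈ Ioc 0 T,
    DifferentiableWithinAt ℝ (fun t' => u x t') (Icc 0 T) t) ∧
  (∀ x ∈ Icc l₁ l₂,
    ContinuousOn (fun t => derivWithin (fun t' => u x t') (Icc 0 T) t) (Ioc 0 T)) ∧
  (∀ x ∈ Ioo l₁ l₂, ∀ t ∈ Ioc 0 T,
    derivWithin (fun t' => u x t') (Icc 0 T) t
      - a ^ 2 * derivWithin (fun x' => derivWithin (fun y => u y t) (Icc l₁ l₂) x')
          (Icc l₁ l₂) x
      + b * u x t = f x t) ∧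
  (∀ x ∈ Icc l₁ l₂, u x 0 = φ x) ∧
  (∀ t ∈ Ioc 0 T,
    α₁ * u l₁ t + β₁ * derivWithin (fun x => u x t) (Icc l₁ l₂) l₁ = g₁ t ∧
    α₂ * u l₂ t + β₂ * derivWithin (fun x => u x t) (Icc l₁ l₂) l₂ = g₂ t)

/-- First-order necessary condition at a constrained maximum on a compact interval. -/
lemma IsMaxOn.hasDerivWithinAt_Icc_mul_sub_nonpos {p q q' x y : ℝ} {f : ℝ → ℝ}
    (hmax : IsMaxOn f (Icc p q) x) (hf : HasDerivWithinAt f q' (Icc p q) x)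
    (hx : x ∈ Icc p q) (hy : y ∈ Icc p q) : q' * (y - x) ≤ 0 := by
  have h := hmax.localize.hasFDerivWithinAt_nonpos hf.hasFDerivWithinAt
    (sub_mem_posTangentConeAt_of_segment_subset ((convex_Icc p q).segment_subset hx hy))
  simpa [mul_comm] using h

/-- Second-order necessary condition at a local maximum. -/
lemma IsLocalMax.second_deriv_nonpos {f f' : ℝ → ℝ} {f'' x : ℝ}
    (hmax : IsLocalMax f x) (hf : ∀ᶠ y in nhds x, HasDerivAt f (f' y) y)
    (hf' : HasDerivAt f' f'' x) : f'' ≤ 0 := by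
  by_contra! hpos
  have hderiv : deriv f =ᶠ[nhds x] f' := hf.mono fun y hy => hy.deriv
  have hdd : HasDerivAt (deriv f) f'' x := hf'.congr_of_eventuallyEq hderiv
  have hmin : IsLocalMin f x := isLocalMin_of_deriv_deriv_pos (by rwa [hdd.deriv])
    hmax.deriv_eq_zero hf.self_of_nhds.continuousAt
  have hconst : f =ᶠ[nhds x] fun _ => f x := by
    filter_upwards [hmax, hmin] with y h₁ h₂ using le_antisymm h₁ h₂
  have hzero : deriv f =ᶠ[nhds x] fun _ => 0 := by simpa using hconst.deriv
  have := (hdd.congr_of_eventuallyEq hzero.symm).unique (hasDerivAt_const x (0 : ℝ))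
  exact hpos.ne' this

/-- A positive weight whose logarithmic derivative is very negative at the left endpoint and very
positive at the right endpoint. -/
lemma exists_robin_weight {l₁ l₂ : ℝ} (hl : l₁ < l₂) (c₁ c₂ : ℝ) :
    ∃ (ψ ψ' ψ'' : ℝ → ℝ) (K : ℝ), (∀ x, 0 < ψ x) ∧ (∀ x, HasDerivAt ψ (ψ' x) x) ∧
      (∀ x, HasDerivAt ψ' (ψ'' x) x) ∧ (∀ x ∈ Icc l₁ l₂, ψ'' x ≤ K * ψ x) ∧
      ψ' l₁ < c₁ * ψ l₁ ∧ c₂ * ψ l₂ < ψ' l₂ := by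
  obtain ⟨s, hs₁, hs₂⟩ : ∃ s : ℝ, s * (l₁ - l₂) < c₁ ∧ c₂ < s * (l₂ - l₁) := by
    have hL : 0 < l₂ - l₁ := sub_pos.2 hl
    refine ⟨(|c₁| + |c₂| + 1) / (l₂ - l₁), ?_, ?_⟩
    · rw [← neg_sub l₂ l₁, mul_neg, div_mul_cancel₀ _ hL.ne']
      linarith [neg_abs_le c₁, abs_nonneg c₂]
    · rw [div_mul_cancel₀ _ hL.ne']
      linarith [le_abs_self c₂, abs_nonneg c₁]
  have hh : ∀ x, HasDerivAt (fun x : ℝ => s * (2 * x - l₁ - l₂)) (2 * s) x := fun x => by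
    have := ((((hasDerivAt_id' x).const_mul 2).sub_const l₁).sub_const l₂).const_mul s
    exact this.congr_deriv (by ring)
  have hψ : ∀ x, HasDerivAt (fun x : ℝ => exp (s * (x - l₁) * (x - l₂)))
      (s * (2 * x - l₁ - l₂) * exp (s * (x - l₁) * (x - l₂))) x := fun x => by
    have := ((((hasDerivAt_id' x).sub_const l₁).const_mul s).fun_mul
      ((hasDerivAt_id' x).sub_const l₂)).exp
    exact this.congr_deriv (by ring)
  refine ⟨_, _, _, 2 * s + (s * (l₂ - l₁)) ^ 2, fun x => exp_pos _, hψ,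
    fun x => (hh x).mul (hψ x), fun x hx => ?_, ?_, ?_⟩
  · have hsq : (2 * x - l₁ - l₂) ^ 2 ≤ (l₂ - l₁) ^ 2 := by nlinarith [hx.1, hx.2]
    have := mul_le_mul_of_nonneg_left hsq (mul_nonneg (sq_nonneg s) (exp_pos
      (s * (x - l₁) * (x - l₂))).le)
    linarith
  · exact mul_lt_mul_of_pos_right (by linarith) (exp_pos _)
  · exact mul_lt_mul_of_pos_right (by linarith) (exp_pos _)

/-- Maximum principle for the homogeneous reaction-diffusion problem with Robin conditions of
arbitrary sign. -/
lemma reactionDiffusion_nonpos {a b l₁ l₂ T α₁ β₁ α₂ β₂ : ℝ} (hl : l₁ < l₂)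
    (hαβ₁ : (α₁, β₁) ≠ (0, 0)) (hαβ₂ : (α₂, β₂) ≠ (0, 0)) {w wx wxx wt : ℝ → ℝ → ℝ}
    (hc : ContinuousOn (fun q : ℝ × ℝ => w q.1 q.2) (Icc l₁ l₂ ×ˢ Icc 0 T))
    (hx : ∀ t ∈ Ioc 0 T, ∀ x ∈ Icc l₁ l₂,
      HasDerivWithinAt (fun y => w y t) (wx x t) (Icc l₁ l₂) x)
    (hxx : ∀ t ∈ Ioc 0 T, ∀ x ∈ Icc l₁ l₂,
      HasDerivWithinAt (fun y => wx y t) (wxx x t) (Icc l₁ l₂) x)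
    (ht : ∀ x ∈ Icc l₁ l₂, ∀ t ∈ Ioc 0 T,
      HasDerivWithinAt (fun s => w x s) (wt x t) (Icc 0 T) t)
    (heq : ∀ x ∈ Ioo l₁ l₂, ∀ t ∈ Ioc 0 T, wt x t - a ^ 2 * wxx x t + b * w x t = 0)
    (hinit : ∀ x ∈ Icc l₁ l₂, w x 0 = 0)
    (hbc : ∀ t ∈ Ioc 0 T, α₁ * w l₁ t + β₁ * wx l₁ t = 0 ∧ α₂ * w l₂ t + β₂ * wx l₂ t = 0)
    {x t : ℝ} (hxI : x ∈ Icc l₁ l₂) (htI : t ∈ Icc 0 T) : w x t ≤ 0 := by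
  obtain ⟨ψ, ψ', ψ'', K, hψ_pos, hψ, hψ', hK, hψ₁, hψ₂⟩ :=
    exists_robin_weight hl (-(α₁ / β₁)) (-(α₂ / β₂))
  obtain ⟨k, hk⟩ : ∃ k, a ^ 2 * K - b < k := exists_gt _
  have hψ_cont : Continuous ψ := continuous_iff_continuousAt.2 fun y => (hψ y).continuousAt
  have hcont : ContinuousOn (fun q : ℝ × ℝ => w q.1 q.2 / (ψ q.1 * exp (k * q.2)))
      (Icc l₁ l₂ ×ˢ Icc 0 T) :=
    hc.div (by fun_prop) fun q _ => (mul_pos (hψ_pos _) (exp_pos _)).ne'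
  obtain ⟨⟨x₀, t₀⟩, ⟨hx₀, ht₀⟩, hmax⟩ :=
    (isCompact_Icc.prod isCompact_Icc).exists_isMaxOn ⟨(x, t), hxI, htI⟩ hcont
  simp only at hx₀ ht₀
  by_contra! hpos
  set M := w x₀ t₀ / (ψ x₀ * exp (k * t₀))
  have hle : ∀ y ∈ Icc l₁ l₂, ∀ s ∈ Icc 0 T, w y s ≤ M * (ψ y * exp (k * s)) :=
    fun y hy s hs => (div_le_iff₀ (mul_pos (hψ_pos _) (exp_pos _))).1
      (hmax (show (y, s) ∈ Icc l₁ l₂ ×ˢ Icc 0 T from ⟨hy, hs⟩))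
  have hw₀ : w x₀ t₀ = M * (ψ x₀ * exp (k * t₀)) :=
    (div_mul_cancel₀ _ (mul_pos (hψ_pos _) (exp_pos _)).ne').symm
  have hMpos : 0 < M := pos_of_mul_pos_left (hpos.trans_le (hle x hxI t htI))
    (mul_pos (hψ_pos _) (exp_pos _)).le
  have hw₀_pos : 0 < w x₀ t₀ := by
    rw [hw₀]; exact mul_pos hMpos (mul_pos (hψ_pos _) (exp_pos _))
  have ht₀_pos : 0 < t₀ := ht₀.1.lt_of_ne fun h => by
    rw [← h, hinit x₀ hx₀] at hw₀_pos; exact lt_irrefl _ hw₀_pos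
  have ht₀' : t₀ ∈ Ioc 0 T := ⟨ht₀_pos, ht₀.2⟩
  obtain ⟨C, hC, hC_pos⟩ : ∃ C, C = M * exp (k * t₀) ∧ 0 < C :=
    ⟨_, rfl, mul_pos hMpos (exp_pos _)⟩
  have hwC : w x₀ t₀ = C * ψ x₀ := by rw [hw₀, hC]; ring
  have hmaxx : IsMaxOn (fun y => w y t₀ - C * ψ y) (Icc l₁ l₂) x₀ := fun y hy => by
    have := hle y hy t₀ ht₀
    simp only [mem_ofPred_eq, hwC, sub_self]
    rw [hC]; linarith
  have hdx : ∀ y ∈ Icc l₁ l₂,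
      HasDerivWithinAt (fun y => w y t₀ - C * ψ y) (wx y t₀ - C * ψ' y) (Icc l₁ l₂) y :=
    fun y hy => (hx t₀ ht₀' y hy).sub ((hψ y).const_mul C).hasDerivWithinAt
  have hdxx : ∀ y ∈ Icc l₁ l₂,
      HasDerivWithinAt (fun y => wx y t₀ - C * ψ' y) (wxx y t₀ - C * ψ'' y) (Icc l₁ l₂) y :=
    fun y hy => (hxx t₀ ht₀' y hy).sub ((hψ' y).const_mul C).hasDerivWithinAt
  -- a Robin or Dirichlet condition at a positive value determines the logarithmic derivative
  have hrobin : ∀ {α β p d : ℝ}, (α, β) ≠ (0, 0) → 0 < p → α * p + β * d = 0 →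
      d = -(α / β) * p := by
    intro α β p d hαβ hp h
    have hβ : β ≠ 0 := by
      rintro rfl
      have : α = 0 := by simpa [hp.ne'] using h
      exact hαβ (by rw [this])
    field_simp
    linarith
  rcases hx₀.1.eq_or_lt with rfl | hx₀l
  · have h := hmaxx.hasDerivWithinAt_Icc_mul_sub_nonpos (hdx _ hx₀) hx₀ (right_mem_Icc.2 hl.le)
    have hd := hrobin hαβ₁ hw₀_pos (hbc t₀ ht₀').1
    rw [hd, hwC] at h
    nlinarith [mul_pos (mul_pos hC_pos (sub_pos.2 hψ₁)) (sub_pos.2 hl)]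
  rcases hx₀.2.eq_or_lt with rfl | hx₀r
  · have h := hmaxx.hasDerivWithinAt_Icc_mul_sub_nonpos (hdx _ hx₀) hx₀ (left_mem_Icc.2 hl.le)
    have hd := hrobin hαβ₂ hw₀_pos (hbc t₀ ht₀').2
    rw [hd, hwC] at h
    nlinarith [mul_pos (mul_pos hC_pos (sub_pos.2 hψ₂)) (sub_pos.2 hl)]
  have hxx_le : wxx x₀ t₀ - C * ψ'' x₀ ≤ 0 := by
    have hnhds : Icc l₁ l₂ ∈ nhds x₀ := Icc_mem_nhds hx₀l hx₀r
    refine (hmaxx.isLocalMax hnhds).second_deriv_nonpos ?_ ((hdxx x₀ hx₀).hasDerivAt hnhds)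
    filter_upwards [Ioo_mem_nhds hx₀l hx₀r] with y hy
    exact (hdx y (Ioo_subset_Icc_self hy)).hasDerivAt (Icc_mem_nhds hy.1 hy.2)
  have ht_ge : k * w x₀ t₀ ≤ wt x₀ t₀ := by
    have hmaxt : IsMaxOn (fun s => w x₀ s - M * ψ x₀ * exp (k * s)) (Icc 0 T) t₀ :=
      fun s hs => by
        have := hle x₀ hx₀ s hs
        simp only [mem_ofPred_eq, hw₀]
        linarith
    have hexp : HasDerivAt (fun s => M * ψ x₀ * exp (k * s))
        (M * ψ x₀ * (exp (k * t₀) * k)) t₀ := by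
      simpa using (((hasDerivAt_id t₀).const_mul k).exp).const_mul (M * ψ x₀)
    have h := hmaxt.hasDerivWithinAt_Icc_mul_sub_nonpos
      ((ht x₀ hx₀ t₀ ht₀').sub hexp.hasDerivWithinAt) ht₀ ⟨le_rfl, ht₀.1.trans ht₀.2⟩
    rw [zero_sub, mul_neg, neg_nonpos] at h
    have h' := nonneg_of_mul_nonneg_left h ht₀_pos
    rw [hw₀]
    linarith
  have hψK := mul_le_mul_of_nonneg_left (hK x₀ hx₀) hC_pos.le
  have hxx_le' : wxx x₀ t₀ ≤ K * w x₀ t₀ := by rw [hwC]; linarith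
  have := mul_le_mul_of_nonneg_left hxx_le' (sq_nonneg a)
  have := mul_pos (sub_pos.2 hk) hw₀_pos
  linarith [heq x₀ ⟨hx₀l, hx₀r⟩ t₀ ht₀']

/-- One-sided comparison of two solutions with the same data. -/
lemma IsRDSolution.le {a b l₁ l₂ T α₁ β₁ α₂ β₂ : ℝ} (hl : l₁ < l₂)
    (hαβ₁ : (α₁, β₁) ≠ (0, 0)) (hαβ₂ : (α₂, β₂) ≠ (0, 0)) {f : ℝ → ℝ → ℝ} {φ g₁ g₂ : ℝ → ℝ}
    {u v : ℝ → ℝ → ℝ} (hu : IsRDSolution a b l₁ l₂ T f φ α₁ β₁ α₂ β₂ g₁ g₂ u)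
    (hv : IsRDSolution a b l₁ l₂ T f φ α₁ β₁ α₂ β₂ g₁ g₂ v)
    {x t : ℝ} (hx : x ∈ Icc l₁ l₂) (ht : t ∈ Icc 0 T) : u x t ≤ v x t := by
  obtain ⟨uc, ux, uxx, -, ut, -, ueq, uinit, ubc⟩ := hu
  obtain ⟨vc, vx, vxx, -, vt, -, veq, vinit, vbc⟩ := hv
  refine sub_nonpos.1 (reactionDiffusion_nonpos (w := fun x t => u x t - v x t) hl hαβ₁ hαβ₂
    (uc.sub vc)
    (fun s hs y hy => (ux s hs y hy).hasDerivWithinAt.sub (vx s hs y hy).hasDerivWithinAt)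
    (fun s hs y hy => (uxx s hs y hy).hasDerivWithinAt.sub (vxx s hs y hy).hasDerivWithinAt)
    (fun y hy s hs => (ut y hy s hs).hasDerivWithinAt.sub (vt y hy s hs).hasDerivWithinAt)
    (a := a) (b := b) (fun y hy s hs => ?_) (fun y hy => ?_) (fun s hs => ⟨?_, ?_⟩) hx ht)
  · linarith [ueq y hy s hs, veq y hy s hs]
  · rw [uinit y hy, vinit y hy, sub_self]
  · linarith [(ubc s hs).1, (vbc s hs).1]
  · linarith [(ubc s hs).2, (vbc s hs).2]

/-- Uniqueness for the linear reaction-diffusion initial-boundary value problem. -/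
theorem stmt_11 (a b l₁ l₂ T : ℝ) (ha : 0 < a) (hl : l₁ < l₂) (hT : 0 < T)
    (α₁ β₁ α₂ β₂ : ℝ) (hαβ₁ : (α₁, β₁) ≠ (0, 0)) (hαβ₂ : (α₂, β₂) ≠ (0, 0))
    (f : ℝ → ℝ → ℝ) (φ : ℝ → ℝ) (g₁ g₂ : ℝ → ℝ) (u₁ u₂ : ℝ → ℝ → ℝ)
    (h₁ : IsRDSolution a b l₁ l₂ T f φ α₁ β₁ α₂ β₂ g₁ g₂ u₁)
    (h₂ : IsRDSolution a b l₁ l₂ T f φ α₁ β₁ α₂ β₂ g₁ g₂ u₂) :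
    ∀ x ∈ Icc l₁ l₂, ∀ t ∈ Icc 0 T, u₁ x t = u₂ x t := by
  exact fun x hx t ht => le_antisymm
    (h₁.le hl hαβ₁ hαβ₂ h₂ hx ht) (h₂.le hl hαβ₁ hαβ₂ h₁ hx ht)
end
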